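/- arXiv:2404.05076 — 11 statements merged into one kernel-verified Lean document; each statement's English description precedes it below -/
import Mathlib

section
/- Fix r > 0, D > 0 and θ ∈ (0, π). Then ∫_{−1/2}^{1/2} (r² D² x² sin²θ)/(r² + D²x² − 2rDx cos θ) dx = (r³ sin²θ / D)·( D/r + cos θ · ln(G₁/G₂) + (cos 2θ / sin θ)·Ξ ). -/
open Real

/-- The denominator of the integrand is positive, by completing the square. -/
theorem ula_denominator_pos {r s : ℝ} (c D x : ℝ) (hr : 0 < r) (hs : 0 < s)
    (hsc : s ^ 2 + c ^ 2 = 1) : 0 < r ^ 2 + D ^ 2 * x ^ 2 - 2 * r * D * x * c := by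
  have h : r ^ 2 + D ^ 2 * x ^ 2 - 2 * r * D * x * c = (D * x - r * c) ^ 2 + (r * s) ^ 2 := by
    linear_combination (-r ^ 2) * hsc
  rw [h]
  positivity

/-- An antiderivative of the integrand, with `s` and `c` the sine and cosine of an angle. -/
theorem hasDerivAt_ula_antiderivative {r s c D : ℝ} (x : ℝ) (hr : 0 < r) (hD : 0 < D)
    (hs : 0 < s) (hsc : s ^ 2 + c ^ 2 = 1) :
    HasDerivAt
      (fun y => r ^ 2 * s ^ 2 *
        (y + r * c / D * Real.log (r ^ 2 + D ^ 2 * y ^ 2 - 2 * r * D * y * c)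
          + r * (2 * c ^ 2 - 1) / (D * s) * arctan ((D * y - r * c) / (r * s))))
      (r ^ 2 * D ^ 2 * x ^ 2 * s ^ 2 / (r ^ 2 + D ^ 2 * x ^ 2 - 2 * r * D * x * c)) x := by
  have hQ := ula_denominator_pos c D x hr hs hsc
  have hq : HasDerivAt (fun y => r ^ 2 + D ^ 2 * y ^ 2 - 2 * r * D * y * c)
      (2 * D ^ 2 * x - 2 * r * D * c) x := by
    have h := ((((hasDerivAt_id x).pow 2).const_mul (D ^ 2)).const_add (r ^ 2)).sub
      (((hasDerivAt_id x).const_mul (2 * r * D)).mul_const c)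
    refine h.congr_deriv ?_
    simp only [id]
    push_cast
    ring
  have ha : HasDerivAt (fun y => (D * y - r * c) / (r * s)) (D / (r * s)) x := by
    simpa using (((hasDerivAt_id x).const_mul D).sub_const (r * c)).div_const (r * s)
  have h := (((hasDerivAt_id x).add ((hq.log hQ.ne').const_mul (r * c / D))).add
    (ha.arctan.const_mul (r * (2 * c ^ 2 - 1) / (D * s)))).const_mul (r ^ 2 * s ^ 2)
  refine h.congr_deriv ?_
  have hden : 1 / (1 + ((D * x - r * c) / (r * s)) ^ 2)
      = (r * s) ^ 2 / (r ^ 2 + D ^ 2 * x ^ 2 - 2 * r * D * x * c) := by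
    have h1 : 1 + ((D * x - r * c) / (r * s)) ^ 2
        = (r ^ 2 + D ^ 2 * x ^ 2 - 2 * r * D * x * c) / (r * s) ^ 2 := by
      field_simp
      linear_combination r ^ 2 * hsc
    rw [h1, one_div_div]
  rw [hden]
  generalize hQ_eq : r ^ 2 + D ^ 2 * x ^ 2 - 2 * r * D * x * c = Q at hQ ⊢
  field_simp
  linear_combination -hQ_eq

/-- closed form of the continuum limit of `u_θ` for a ULA
(Theorem 1, eq. (34)). -/
theorem ula_utheta_integral (r D θ : ℝ) (hr : 0 < r) (hD : 0 < D)
    (hθ : θ ∈ Set.Ioo 0 π)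
    (G₁ G₂ Ξ : ℝ)
    (hG₁ : G₁ = D ^ 2 / 4 - r * D * cos θ + r ^ 2)
    (hG₂ : G₂ = D ^ 2 / 4 + r * D * cos θ + r ^ 2)
    (hΞ : Ξ = arctan ((D - 2 * r * cos θ) / (2 * r * sin θ))
            + arctan ((D + 2 * r * cos θ) / (2 * r * sin θ))) :
    ∫ x in (-(1 / 2) : ℝ)..(1 / 2),
        (r ^ 2 * D ^ 2 * x ^ 2 * sin θ ^ 2) / (r ^ 2 + D ^ 2 * x ^ 2 - 2 * r * D * x * cos θ)
      = (r ^ 3 * sin θ ^ 2 / D) *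
          (D / r + cos θ * Real.log (G₁ / G₂) + (cos (2 * θ) / sin θ) * Ξ) := by
  obtain ⟨h0, hpi⟩ := hθ
  have hs : 0 < sin θ := sin_pos_of_pos_of_lt_pi h0 hpi
  have hsc := sin_sq_add_cos_sq θ
  have hpos x := ula_denominator_pos (cos θ) D x hr hs hsc
  have hcont : Continuous fun x : ℝ => r ^ 2 * D ^ 2 * x ^ 2 * sin θ ^ 2 /
      (r ^ 2 + D ^ 2 * x ^ 2 - 2 * r * D * x * cos θ) :=
    Continuous.div (by fun_prop) (by fun_prop) fun x => (hpos x).ne'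
  rw [intervalIntegral.integral_eq_sub_of_hasDerivAt
    (fun x _ => hasDerivAt_ula_antiderivative x hr hD hs hsc) (hcont.intervalIntegrable _ _)]
  have e₁ : r ^ 2 + D ^ 2 * (1 / 2) ^ 2 - 2 * r * D * (1 / 2) * cos θ = G₁ := by
    rw [hG₁]; ring
  have e₂ : r ^ 2 + D ^ 2 * (-(1 / 2)) ^ 2 - 2 * r * D * (-(1 / 2)) * cos θ = G₂ := by
    rw [hG₂]; ring
  have hG₁pos : 0 < G₁ := e₁ ▸ hpos (1 / 2)
  have hG₂pos : 0 < G₂ := e₂ ▸ hpos (-(1 / 2))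
  have a₁ : (D * (1 / 2) - r * cos θ) / (r * sin θ)
      = (D - 2 * r * cos θ) / (2 * r * sin θ) := by
    field_simp
  have a₂ : (D * (-(1 / 2)) - r * cos θ) / (r * sin θ)
      = -((D + 2 * r * cos θ) / (2 * r * sin θ)) := by
    field_simp
    ring
  rw [e₁, e₂, a₁, a₂, arctan_neg, Real.log_div hG₁pos.ne' hG₂pos.ne', cos_two_mul, hΞ]
  field_simp
  ring
end

section
/- Fix r > 0, D > 0 and θ ∈ (0, π). Then ∫_{−1/2}^{1/2} (r D x sin θ)/√(r² + D²x² − 2rDx cos θ) dx = (r² sin θ / D)·( (√G₁ − √G₂)/r + cos θ · ln( (√G₁ + D/2 − r cos θ)/(√G₂ − D/2 − r cos θ) ) ). -/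
open Real

/-- The distance exceeds its component along the array: complete the square. -/
lemma abs_lt_sqrt_dist {r θ : ℝ} (hr : 0 < r) (hθ : 0 < sin θ) (D x : ℝ) :
    |D * x - r * cos θ| < √(r ^ 2 + D ^ 2 * x ^ 2 - 2 * r * D * x * cos θ) := by
  apply Real.lt_sqrt_of_sq_lt
  rw [sq_abs]
  have hpos : 0 < r ^ 2 * sin θ ^ 2 := by positivity
  linear_combination hpos + r ^ 2 * sin_sq_add_cos_sq θ

/-- An antiderivative of the integrand of the uniform linear array integral. -/
lemma hasDerivAt_ula_antideriv {r D θ : ℝ} (hr : 0 < r) (hD : 0 < D) (hθ : 0 < sin θ) (x : ℝ) :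
    HasDerivAt
      (fun x => r * sin θ / D * (√(r ^ 2 + D ^ 2 * x ^ 2 - 2 * r * D * x * cos θ) +
        r * cos θ *
          log (√(r ^ 2 + D ^ 2 * x ^ 2 - 2 * r * D * x * cos θ) + (D * x - r * cos θ))))
      ((r * D * x * sin θ) / √(r ^ 2 + D ^ 2 * x ^ 2 - 2 * r * D * x * cos θ)) x := by
  have habs := abs_lt_sqrt_dist hr hθ D x
  have hS := (abs_nonneg _).trans_lt habs
  have hL : √(r ^ 2 + D ^ 2 * x ^ 2 - 2 * r * D * x * cos θ) + (D * x - r * cos θ) ≠ 0 := by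
    have := (abs_lt.1 habs).1
    exact ne_of_gt (by linarith)
  have hQ' : HasDerivAt (fun x => r ^ 2 + D ^ 2 * x ^ 2 - 2 * r * D * x * cos θ)
      (2 * D * (D * x - r * cos θ)) x := by
    have h := ((((hasDerivAt_id x).pow 2).const_mul (D ^ 2)).const_add (r ^ 2)).sub
      (((hasDerivAt_id x).const_mul (2 * r * D)).mul_const (cos θ))
    refine h.congr_deriv ?_
    simp only [id]
    ring
  have hS' := hQ'.sqrt (Real.sqrt_pos.1 hS).ne'
  have hu' : HasDerivAt (fun x => D * x - r * cos θ) D x := by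
    simpa using ((hasDerivAt_id x).const_mul D).sub_const (r * cos θ)
  have hF := (hS'.add (((hS'.add hu').log hL).const_mul
    (r * cos θ))).const_mul (r * sin θ / D)
  refine hF.congr_deriv ?_
  simp only [Pi.add_apply]
  set S := √(r ^ 2 + D ^ 2 * x ^ 2 - 2 * r * D * x * cos θ)
  have hlog : (2 * D * (D * x - r * cos θ) / (2 * S) + D) / (S + (D * x - r * cos θ)) = D / S := by
    rw [div_eq_div_iff hL hS.ne']
    field_simp
    ring
  rw [hlog]
  field_simp
  ring

/-- closed form of the continuum limit of `c_θ` for a ULA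
(Theorem 1, eq. (36)). -/
theorem ula_ctheta_integral (r D θ : ℝ) (hr : 0 < r) (hD : 0 < D)
    (hθ : θ ∈ Set.Ioo 0 π)
    (G₁ G₂ : ℝ)
    (hG₁ : G₁ = D ^ 2 / 4 - r * D * cos θ + r ^ 2)
    (hG₂ : G₂ = D ^ 2 / 4 + r * D * cos θ + r ^ 2) :
    ∫ x in (-(1 / 2) : ℝ)..(1 / 2),
        (r * D * x * sin θ) / Real.sqrt (r ^ 2 + D ^ 2 * x ^ 2 - 2 * r * D * x * cos θ)
      = (r ^ 2 * sin θ / D) *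
          ((Real.sqrt G₁ - Real.sqrt G₂) / r +
            cos θ * Real.log ((Real.sqrt G₁ + D / 2 - r * cos θ) /
              (Real.sqrt G₂ - D / 2 - r * cos θ))) := by
  have hs : 0 < sin θ := sin_pos_of_mem_Ioo hθ
  have hpos (x : ℝ) : 0 < √(r ^ 2 + D ^ 2 * x ^ 2 - 2 * r * D * x * cos θ) :=
    (abs_nonneg _).trans_lt (abs_lt_sqrt_dist hr hs D x)
  have hcont : Continuous fun x : ℝ =>
      (r * D * x * sin θ) / √(r ^ 2 + D ^ 2 * x ^ 2 - 2 * r * D * x * cos θ) :=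
    Continuous.div (by fun_prop) (by fun_prop) fun x => (hpos x).ne'
  rw [intervalIntegral.integral_eq_sub_of_hasDerivAt
    (fun x _ => hasDerivAt_ula_antideriv hr hD hs x) (hcont.intervalIntegrable _ _)]
  have h₁ : r ^ 2 + D ^ 2 * (1 / 2) ^ 2 - 2 * r * D * (1 / 2) * cos θ = G₁ := by
    rw [hG₁]; ring
  have h₂ : r ^ 2 + D ^ 2 * (-(1 / 2)) ^ 2 - 2 * r * D * (-(1 / 2)) * cos θ = G₂ := by
    rw [hG₂]; ring
  have hlt₁ := abs_lt_sqrt_dist hr hs D (1 / 2)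
  have hlt₂ := abs_lt_sqrt_dist hr hs D (-(1 / 2))
  rw [h₁] at hlt₁ ⊢
  rw [h₂] at hlt₂ ⊢
  have e₁ : √G₁ + (D * (1 / 2) - r * cos θ) = √G₁ + D / 2 - r * cos θ := by ring
  have e₂ : √G₂ + (D * (-(1 / 2)) - r * cos θ) = √G₂ - D / 2 - r * cos θ := by ring
  have hne₁ : √G₁ + D / 2 - r * cos θ ≠ 0 := ne_of_gt (by linarith [(abs_lt.1 hlt₁).1])
  have hne₂ : √G₂ - D / 2 - r * cos θ ≠ 0 := ne_of_gt (by linarith [(abs_lt.1 hlt₂).1])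
  rw [e₁, e₂, log_div hne₁ hne₂]
  field_simp
  ring
end

section
/- Let r > 0 and R > 0 with r ≠ R. Then ∫_0^{2π} sin²x / (r² + R² − 2rR cos x) dx = π / max(r, R)². -/
open Real

theorem sq_add_sq_sub_mul_cos_pos {a b : ℝ} (ha : 0 < a) (hab : a < b) (x : ℝ) :
    0 < a ^ 2 + b ^ 2 - 2 * a * b * cos x := by
  nlinarith [mul_nonneg (mul_pos ha (ha.trans hab)).le (sub_nonneg.2 (cos_le_one x)),
    pow_pos (sub_pos.2 hab) 2]

theorem hasDerivAt_sin_sq_div_primitive {a b : ℝ} (ha : 0 < a) (hab : a < b) (x : ℝ) :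
    HasDerivAt
      (fun x ↦ (a ^ 2 * x - (b ^ 2 - a ^ 2) * arctan (a * sin x / (b - a * cos x))
        + a * b * sin x) / (2 * a ^ 2 * b ^ 2))
      (sin x ^ 2 / (a ^ 2 + b ^ 2 - 2 * a * b * cos x)) x := by
  have hb : 0 < b := ha.trans hab
  have hD := sq_add_sq_sub_mul_cos_pos ha hab x
  have hE : 0 < b - a * cos x := by nlinarith [cos_le_one x]
  have hsin : sin x ^ 2 = 1 - cos x ^ 2 := sin_sq x
  have hquot : HasDerivAt (fun x ↦ a * sin x / (b - a * cos x))
      ((a * b * cos x - a ^ 2) / (b - a * cos x) ^ 2) x := by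
    refine (((hasDerivAt_sin x).const_mul a).div
      (((hasDerivAt_cos x).const_mul a).const_sub b) hE.ne').congr_deriv ?_
    congr 1
    linear_combination -a ^ 2 * hsin
  have harctan : HasDerivAt (fun x ↦ arctan (a * sin x / (b - a * cos x)))
      ((a * b * cos x - a ^ 2) / (a ^ 2 + b ^ 2 - 2 * a * b * cos x)) x := by
    refine hquot.arctan.congr_deriv ?_
    have hden : 1 + (a * sin x / (b - a * cos x)) ^ 2
        = (a ^ 2 + b ^ 2 - 2 * a * b * cos x) / (b - a * cos x) ^ 2 := by
      field_simp
      linear_combination a ^ 2 * hsin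
    rw [hden]
    field_simp
  refine (((((hasDerivAt_id x).const_mul (a ^ 2)).sub (harctan.const_mul (b ^ 2 - a ^ 2))).add
    ((hasDerivAt_sin x).const_mul (a * b))).div_const (2 * a ^ 2 * b ^ 2)).congr_deriv ?_
  rw [hsin]
  generalize hDdef : a ^ 2 + b ^ 2 - 2 * a * b * cos x = D at hD ⊢
  field_simp
  rw [← hDdef]
  ring

theorem integral_sin_sq_div_of_lt {a b : ℝ} (ha : 0 < a) (hab : a < b) :
    ∫ x in (0 : ℝ)..(2 * π), sin x ^ 2 / (a ^ 2 + b ^ 2 - 2 * a * b * cos x) = π / b ^ 2 := by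
  have hb : 0 < b := ha.trans hab
  rw [intervalIntegral.integral_eq_sub_of_hasDerivAt
    (fun x _ ↦ hasDerivAt_sin_sq_div_primitive ha hab x)]
  · simp only [sin_two_pi, sin_zero, mul_zero, zero_div, arctan_zero]
    field_simp
    ring
  · refine Continuous.intervalIntegrable ?_ _ _
    exact Continuous.div (by fun_prop) (by fun_prop)
      fun x ↦ (sq_add_sq_sub_mul_cos_pos ha hab x).ne'

/-- `∫₀^{2π} sin²x / (r² + R² − 2rR cos x) dx = π / max(r,R)²`
(a case of Gradshteyn–Ryzhik 3.613.3), used for the UCA parameter `u_θ`. -/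
theorem uca_sin_sq_integral (r R : ℝ) (hr : 0 < r) (hR : 0 < R) (hne : r ≠ R) :
    ∫ x in (0 : ℝ)..(2 * π),
        sin x ^ 2 / (r ^ 2 + R ^ 2 - 2 * r * R * cos x)
      = π / (max r R) ^ 2 := by
  rcases hne.lt_or_gt with h | h
  · rw [max_eq_right h.le, integral_sin_sq_div_of_lt hr h]
  · rw [max_eq_left h.le, ← integral_sin_sq_div_of_lt hR h, add_comm (r ^ 2), mul_right_comm 2 r R]
end

section
/- The function Υ : [0, ∞) → ℝ defined by Υ(α) = ∫_0^{2π} (α − cos x)/(2π·√(1 − 2α cos x + α²)) dx is strictly monotonically increasing on [0, ∞). -/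
open Real

/-- The transcendental function `Υ(α) = ∫₀^{2π} (α − cos x)/(2π·√(1 − 2α cos x + α²)) dx`. -/
noncomputable def Upsilon (α : ℝ) : ℝ :=
  ∫ x in (0 : ℝ)..(2 * π),
    (α - cos x) / (2 * π * Real.sqrt (1 - 2 * α * cos x + α ^ 2))

theorem strictMono_div_sqrt_sq_add {d : ℝ} (hd : 0 < d) :
    StrictMono fun t : ℝ => t / √(t ^ 2 + d) := by
  intro a b hab
  have hA : 0 < √(a ^ 2 + d) := sqrt_pos.2 (by positivity)
  have hB : 0 < √(b ^ 2 + d) := sqrt_pos.2 (by positivity)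
  have hAB : a * b ≤ √(a ^ 2 + d) * √(b ^ 2 + d) := by
    rw [← sqrt_mul (by positivity)]
    apply le_sqrt_of_sq_le
    nlinarith [mul_nonneg hd.le (sq_nonneg a), mul_nonneg hd.le (sq_nonneg b), mul_pos hd hd]
  have hA2 : √(a ^ 2 + d) ^ 2 = a ^ 2 + d := sq_sqrt (by positivity)
  have hB2 : √(b ^ 2 + d) ^ 2 = b ^ 2 + d := sq_sqrt (by positivity)
  change a / √(a ^ 2 + d) < b / √(b ^ 2 + d)
  generalize √(a ^ 2 + d) = A at *
  generalize √(b ^ 2 + d) = B at *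
  rw [div_lt_div_iff₀ hA hB, ← sub_pos]
  refine pos_of_mul_pos_left (b := A + B) ?_ (by positivity)
  have key : (b * A - a * B) * (A + B) = (b - a) * (d - a * b + A * B) := by
    linear_combination b * hA2 - a * hB2
  rw [key]
  exact mul_pos (sub_pos.2 hab) (by linarith)

theorem monotone_div_sqrt_sq_add {d : ℝ} (hd : 0 ≤ d) :
    Monotone fun t : ℝ => t / √(t ^ 2 + d) := by
  rcases hd.eq_or_lt with rfl | hd
  · intro a b hab
    simp only [add_zero, sqrt_sq_eq_abs]
    rcases lt_trichotomy a 0 with ha | rfl | ha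
    · rw [abs_of_neg ha, div_neg, div_self ha.ne]
      have h := abs_div b |b|
      rw [abs_abs] at h
      exact (abs_le.1 (h.trans_le (div_self_le_one _))).1
    · rw [zero_div]
      positivity
    · have hb := ha.trans_le hab
      rw [abs_of_pos ha, abs_of_pos hb, div_self ha.ne', div_self hb.ne']
  · exact (strictMono_div_sqrt_sq_add hd).monotone

theorem Upsilon_integrand_eq (α x : ℝ) :
    (α - cos x) / (2 * π * √(1 - 2 * α * cos x + α ^ 2)) =
      (α - cos x) / √((α - cos x) ^ 2 + sin x ^ 2) / (2 * π) := by
  rw [sin_sq, div_div, mul_comm (2 * π)]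
  ring_nf

theorem Upsilon_integrand_intervalIntegrable (α a b : ℝ) :
    IntervalIntegrable (fun x => (α - cos x) / (2 * π * √(1 - 2 * α * cos x + α ^ 2)))
      MeasureTheory.volume a b := by
  simp only [Upsilon_integrand_eq]
  refine IntervalIntegrable.div_const ?_ _
  refine (intervalIntegrable_const (c := (1 : ℝ))).mono_fun
    (Measurable.aestronglyMeasurable (by fun_prop)) (Filter.Eventually.of_forall fun x => ?_)
  beta_reduce
  rw [norm_eq_abs, abs_div, abs_of_nonneg (sqrt_nonneg _), norm_one]
  exact div_le_one_of_le₀ (abs_le_sqrt (le_add_of_nonneg_right (sq_nonneg _))) (sqrt_nonneg _)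

/-- `Υ` is strictly monotonically increasing on `[0, ∞)` (Theorem 2). -/
theorem Upsilon_strictMonoOn : StrictMonoOn Upsilon (Set.Ici (0 : ℝ)) := by
  intro α _ β _ hαβ
  refine intervalIntegral.integral_lt_integral_of_ae_le_of_measure_setOfPred_lt_ne_zero
    two_pi_pos.le (Upsilon_integrand_intervalIntegrable α _ _)
    (Upsilon_integrand_intervalIntegrable β _ _)
    (Filter.Eventually.of_forall fun x => ?_) ?_
  · simp only [Upsilon_integrand_eq]
    exact div_le_div_of_nonneg_right
      (monotone_div_sqrt_sq_add (sq_nonneg (sin x)) (sub_le_sub_right hαβ.le _)) two_pi_pos.le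
  · refine mt (MeasureTheory.measure_mono_null (s := Set.Ioo 0 π) ?_) (ne_of_gt ?_)
    · intro x hx
      simp only [Upsilon_integrand_eq, Set.mem_ofPred_eq]
      exact div_lt_div_of_pos_right
        (strictMono_div_sqrt_sq_add (pow_pos (sin_pos_of_mem_Ioo hx) 2)
          (sub_lt_sub_right hαβ _)) two_pi_pos
    · have hsub : Set.Ioo 0 π ⊆ Set.Ioc 0 (2 * π) :=
        fun x hx => ⟨hx.1, by linarith [hx.2, pi_pos]⟩
      rw [MeasureTheory.Measure.restrict_apply measurableSet_Ioo,
        Set.inter_eq_left.2 hsub, Real.volume_Ioo]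
      simpa using pi_pos
end

section
/- Let Υ(α) = ∫_0^{2π} (α − cos x)/(2π·√(1 − 2α cos x + α²)) dx for α ≥ 0. Then Υ(α) → 1 as α → +∞. -/
open Real

theorem one_sub_two_mul_cos_add_sq (α x : ℝ) :
    1 - 2 * α * cos x + α ^ 2 = (α - cos x) ^ 2 + sin x ^ 2 := by
  linear_combination -(sin_sq_add_cos_sq x)

theorem abs_div_sqrt_sq_add_sq_le_one (u s : ℝ) : |u / √(u ^ 2 + s ^ 2)| ≤ 1 := by
  rw [abs_div, abs_of_nonneg (sqrt_nonneg _)]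
  exact div_le_one_of_le₀ (abs_le_sqrt (by nlinarith [sq_nonneg s])) (sqrt_nonneg _)

theorem tendsto_div_sqrt_sq_add_sq_atTop (s : ℝ) :
    Filter.Tendsto (fun u : ℝ => u / √(u ^ 2 + s ^ 2)) Filter.atTop (nhds 1) := by
  have h : Filter.Tendsto (fun u : ℝ => (√(1 + (s / u) ^ 2))⁻¹) Filter.atTop (nhds 1) := by
    have h₀ : Filter.Tendsto (fun u : ℝ => s / u) Filter.atTop (nhds 0) :=
      Filter.Tendsto.const_div_atTop Filter.tendsto_id s
    simpa using (((h₀.pow 2).const_add 1).sqrt).inv₀ (by simp)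
  refine h.congr' ?_
  filter_upwards [Filter.eventually_gt_atTop 0] with u hu
  have e : u ^ 2 + s ^ 2 = u ^ 2 * (1 + (s / u) ^ 2) := by field_simp
  rw [e, sqrt_mul (sq_nonneg u), sqrt_sq hu.le]
  field_simp

/-- `Υ(α) → 1` as `α → +∞` (key step of Corollary 9). -/
theorem Upsilon_tendsto_one :
    Filter.Tendsto Upsilon Filter.atTop (nhds 1) := by
  have hF (α x : ℝ) : (α - cos x) / (2 * π * √(1 - 2 * α * cos x + α ^ 2)) =
      (2 * π)⁻¹ * ((α - cos x) / √((α - cos x) ^ 2 + sin x ^ 2)) := by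
    rw [one_sub_two_mul_cos_add_sq, div_mul_eq_div_div_swap, div_eq_inv_mul]
  have h1 : (1 : ℝ) = ∫ _ in (0 : ℝ)..(2 * π), (2 * π)⁻¹ := by
    rw [intervalIntegral.integral_const, smul_eq_mul, sub_zero, mul_inv_cancel₀ (by positivity)]
  rw [h1]
  unfold Upsilon
  refine intervalIntegral.tendsto_integral_filter_of_dominated_convergence
    (fun _ => (2 * π)⁻¹) (.of_forall fun α => ?_) (.of_forall fun α => .of_forall fun x _ => ?_)
    intervalIntegrable_const (.of_forall fun x _ => ?_)
  · exact Measurable.aestronglyMeasurable (by fun_prop)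
  · rw [hF, norm_mul, norm_of_nonneg (by positivity : (0 : ℝ) ≤ (2 * π)⁻¹)]
    exact mul_le_of_le_one_right (by positivity) (abs_div_sqrt_sq_add_sq_le_one _ _)
  · simp only [hF]
    simpa [sub_eq_add_neg] using ((tendsto_div_sqrt_sq_add_sq_atTop (sin x)).comp
      (Filter.tendsto_atTop_add_const_right _ (-cos x) Filter.tendsto_id)).const_mul (2 * π)⁻¹
end

section
/- Fix positive integers N, M and positive reals ρ, L, f_c, Δf, r, D, and suppose N·M·M₂·u_r + U·c_r² ≠ 0, where the intermediates are the broadside (θ = π/2) values u_θ = N r² Φ(D/r), u_r = N(1 − Φ(D/r)), c_θ = 0, c_r = N Ψ(D/r), ε = 0. Then CRB_r = 3 / ( ρ L N M · [ 12 f_c² (1 − Φ(D/r) − Ψ²(D/r)) + (B² − Δf²)(1 − Φ(D/r) + Ψ²(D/r)) ] ). -/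
open Real

/-- `Φ(α) = 1 − (2/α)·arctan(α/2)`. -/
noncomputable def PhiULA (α : ℝ) : ℝ := 1 - (2 / α) * arctan (α / 2)

/-- `Ψ(α) = (1/α)·ln((√(α²+4) + α)/(√(α²+4) − α))`. -/
noncomputable def PsiULA (α : ℝ) : ℝ :=
  (1 / α) * Real.log ((Real.sqrt (α ^ 2 + 4) + α) / (Real.sqrt (α ^ 2 + 4) - α))

theorem PhiULA_pos {α : ℝ} (hα : 0 < α) : 0 < PhiULA α := by
  have h : arctan (α / 2) < α / 2 := by
    have := lt_tan (arctan_pos.2 (half_pos hα)) (arctan_lt_pi_div_two (α / 2))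
    rwa [tan_arctan] at this
  have h' : 2 / α * arctan (α / 2) < 2 / α * (α / 2) := by gcongr
  have hone : 2 / α * (α / 2) = 1 := by field_simp
  rw [PhiULA]
  linarith

/-- Corollary 1's closed-form distance CRB of a ULA with a
broadside target (`θ = π/2`). -/
theorem ula_broadside_crb_r (N M : ℕ) (hN : 0 < N) (hM : 0 < M)
    (ρ L f_c Δf r D : ℝ)
    (hρ : 0 < ρ) (hL : 0 < L) (hfc : 0 < f_c) (hΔf : 0 < Δf) (hr : 0 < r) (hD : 0 < D)
    (B M₁ M₂ U uθ ur cθ cr ε φ ψ CRBr : ℝ)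
    (hB : B = M * Δf) (hM₁ : M₁ = M * f_c)
    (hM₂ : M₂ = M * f_c ^ 2 + M * ((M : ℝ) ^ 2 - 1) * Δf ^ 2 / 12)
    (hU : U = M * M₂ - 2 * M₁ ^ 2)
    (huθ : uθ = N * r ^ 2 * PhiULA (D / r))
    (hur : ur = N * (1 - PhiULA (D / r)))
    (hcθ : cθ = 0)
    (hcr : cr = N * PsiULA (D / r))
    (hε : ε = 0)
    (hφ : φ = uθ * ur - ε ^ 2)
    (hψ : ψ = uθ * cr ^ 2 + ur * cθ ^ 2 - 2 * ε * cθ * cr)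
    (hden : (N : ℝ) * M * M₂ * ur + U * cr ^ 2 ≠ 0)
    (hCRB : CRBr = ((N : ℝ) * M * M₂ * uθ + U * cθ ^ 2) /
      (4 * ρ * L * M₂ * ((N : ℝ) * M * M₂ * φ + U * ψ))) :
    CRBr = 3 / (ρ * L * N * M *
      (12 * f_c ^ 2 * (1 - PhiULA (D / r) - PsiULA (D / r) ^ 2) +
        (B ^ 2 - Δf ^ 2) * (1 - PhiULA (D / r) + PsiULA (D / r) ^ 2))) := by
  have hΦ := PhiULA_pos (div_pos hD hr)
  generalize PhiULA (D / r) = P at *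
  generalize PsiULA (D / r) = Q at *
  have hN' : (0 : ℝ) < N := by exact_mod_cast hN
  have hM' : (1 : ℝ) ≤ M := by exact_mod_cast hM
  have hM₀ : (0 : ℝ) < M := by linarith
  have hM₂pos : 0 < M₂ := by
    have : (0 : ℝ) ≤ (M : ℝ) ^ 2 - 1 := by nlinarith
    rw [hM₂]
    positivity
  have huθpos : 0 < uθ := by rw [huθ]; positivity
  have hkey : (N : ℝ) * M * M₂ * ur + U * cr ^ 2 = (N : ℝ) ^ 2 * M ^ 2 / 12 *
      (12 * f_c ^ 2 * (1 - P - Q ^ 2) + (B ^ 2 - Δf ^ 2) * (1 - P + Q ^ 2)) := by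
    subst hB hM₁ hU hur hcr
    rw [hM₂]
    ring
  have hfactor : (N : ℝ) * M * M₂ * φ + U * ψ =
      uθ * ((N : ℝ) * M * M₂ * ur + U * cr ^ 2) := by
    rw [hφ, hψ, hcθ, hε]
    ring
  rw [hkey] at hden hfactor
  generalize 12 * f_c ^ 2 * (1 - P - Q ^ 2) + (B ^ 2 - Δf ^ 2) * (1 - P + Q ^ 2) = E at *
  have hE : E ≠ 0 := right_ne_zero_of_mul hden
  rw [hCRB, hfactor, hcθ]
  field_simp
  ring
end

section
/- Fix r > 0 and θ ∈ (0, π). Then ln( (√G₁(D) + D/2 − r cos θ)/(√G₂(D) − D/2 − r cos θ) ) − 2·ln( D/(r sin θ) ) → 0 as D → +∞. -/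
open Real Filter

/-- The conjugate of `√(x² + b²) - x` is positive. -/
lemma sqrt_sq_add_sq_add_pos (x : ℝ) {b : ℝ} (hb : b ≠ 0) : 0 < √(x ^ 2 + b ^ 2) + x := by
  have h : |x| < √(x ^ 2 + b ^ 2) := by
    rw [← Real.sqrt_sq_eq_abs]
    exact Real.sqrt_lt_sqrt (sq_nonneg x) (lt_add_of_pos_right _ (by positivity))
  linarith [neg_abs_le x]

lemma tendsto_log_sqrt_add_div (a b : ℝ) :
    Tendsto (fun D : ℝ => Real.log ((√((D / 2 + a) ^ 2 + b ^ 2) + (D / 2 + a)) / D))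
      atTop (nhds 0) := by
  have hcont : Continuous fun u : ℝ => √((1 / 2 + a * u) ^ 2 + (b * u) ^ 2) + (1 / 2 + a * u) := by
    fun_prop
  have hlim := (hcont.tendsto 0).comp tendsto_inv_atTop_zero
  have hval : √((1 / 2 + a * 0) ^ 2 + (b * 0) ^ 2) + (1 / 2 + a * 0) = (1 : ℝ) := by
    norm_num
  rw [hval] at hlim
  rw [← Real.log_one]
  refine (hlim.congr' ?_).log one_ne_zero
  filter_upwards [eventually_gt_atTop 0] with D hD
  have hsqrt : √((1 / 2 + a * D⁻¹) ^ 2 + (b * D⁻¹) ^ 2) = √((D / 2 + a) ^ 2 + b ^ 2) / D := by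
    nth_rewrite 4 [← Real.sqrt_sq hD.le]
    rw [← Real.sqrt_div' _ (sq_nonneg D)]
    congr 1
    field_simp
  simp only [Function.comp_apply, hsqrt]
  field_simp

/-- the logarithmic term in Theorem 1's closed-form intermediates
behaves like `ln((D/(r sin θ))²)` as the aperture `D → +∞` (used in the proof
of Corollary 3). -/
theorem ula_log_term_asymptotic (r θ : ℝ) (hr : 0 < r) (hθ : θ ∈ Set.Ioo 0 π) :
    Tendsto (fun D : ℝ =>
        Real.log ((Real.sqrt (D ^ 2 / 4 - r * D * cos θ + r ^ 2) + D / 2 - r * cos θ) /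
            (Real.sqrt (D ^ 2 / 4 + r * D * cos θ + r ^ 2) - D / 2 - r * cos θ))
          - 2 * Real.log (D / (r * sin θ)))
      atTop (nhds 0) := by
  have hb : r * sin θ ≠ 0 := (mul_pos hr (sin_pos_of_mem_Ioo hθ)).ne'
  have hsum := (tendsto_log_sqrt_add_div (-(r * cos θ)) (r * sin θ)).add
    (tendsto_log_sqrt_add_div (r * cos θ) (r * sin θ))
  rw [add_zero] at hsum
  refine hsum.congr' ?_
  filter_upwards [eventually_gt_atTop 0] with D hD
  have hG₁ : D ^ 2 / 4 - r * D * cos θ + r ^ 2 =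
      (D / 2 + -(r * cos θ)) ^ 2 + (r * sin θ) ^ 2 := by
    linear_combination -r ^ 2 * sin_sq_add_cos_sq θ
  have hG₂ : D ^ 2 / 4 + r * D * cos θ + r ^ 2 =
      (D / 2 + r * cos θ) ^ 2 + (r * sin θ) ^ 2 := by
    linear_combination -r ^ 2 * sin_sq_add_cos_sq θ
  have hpos₁ := sqrt_sq_add_sq_add_pos (D / 2 + -(r * cos θ)) hb
  have hpos₂ := sqrt_sq_add_sq_add_pos (D / 2 + r * cos θ) hb
  have hsq := Real.sq_sqrt
    (add_nonneg (sq_nonneg (D / 2 + r * cos θ)) (sq_nonneg (r * sin θ)))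
  rw [hG₁, hG₂]
  set S₁ := √((D / 2 + -(r * cos θ)) ^ 2 + (r * sin θ) ^ 2)
  set S₂ := √((D / 2 + r * cos θ) ^ 2 + (r * sin θ) ^ 2)
  have hnum : S₁ + D / 2 - r * cos θ = S₁ + (D / 2 + -(r * cos θ)) := by ring
  have hden : S₂ - D / 2 - r * cos θ = (r * sin θ) ^ 2 / (S₂ + (D / 2 + r * cos θ)) := by
    rw [eq_div_iff hpos₂.ne']
    linear_combination hsq
  rw [hnum, hden, Real.log_div hpos₁.ne' hD.ne', Real.log_div hpos₂.ne' hD.ne',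
    Real.log_div hpos₁.ne' (div_ne_zero (pow_ne_zero 2 hb) hpos₂.ne'),
    Real.log_div (pow_ne_zero 2 hb) hpos₂.ne', Real.log_div hD.ne' hb, Real.log_pow]
  push_cast
  ring
end

section
/- Fix D > 0 and θ ∈ (0, π). Then (r³ sin²θ / D)·( D/r + cos θ · ln(G₁(r)/G₂(r)) + (cos 2θ / sin θ)·Ξ(r) ) → D² sin²θ / 12 as r → +∞. -/
open Real Filter

theorem one_sub_two_mul_add_sq_pos {s c : ℝ} (hs : 0 < s) (hsc : s ^ 2 + c ^ 2 = 1) (x : ℝ) :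
    0 < x ^ 2 - 2 * x * c + 1 := by
  nlinarith [sq_nonneg (x - c), pow_pos hs 2]

theorem one_add_two_mul_add_sq_pos {s c : ℝ} (hs : 0 < s) (hsc : s ^ 2 + c ^ 2 = 1) (x : ℝ) :
    0 < x ^ 2 + 2 * x * c + 1 := by
  nlinarith [sq_nonneg (x + c), pow_pos hs 2]

/-- The closed form of the aperture sum, as a function of `x = D / (2 r)`, with `s = sin θ` and
`c = cos θ`. -/
noncomputable def apertureProfile (s c x : ℝ) : ℝ :=
  2 * x + c * Real.log ((x ^ 2 - 2 * x * c + 1) / (x ^ 2 + 2 * x * c + 1)) +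
    ((2 * c ^ 2 - 1) / s) * (arctan ((x - c) / s) + arctan ((x + c) / s))

theorem apertureProfile_zero (s c : ℝ) : apertureProfile s c 0 = 0 := by
  simp [apertureProfile, neg_div, arctan_neg]

theorem hasDerivAt_apertureProfile {s c : ℝ} (hs : 0 < s) (hsc : s ^ 2 + c ^ 2 = 1) (x : ℝ) :
    HasDerivAt (apertureProfile s c)
      (x ^ 2 * (1 / (x ^ 2 - 2 * x * c + 1) + 1 / (x ^ 2 + 2 * x * c + 1))) x := by
  have h₁ := one_sub_two_mul_add_sq_pos hs hsc x
  have h₂ := one_add_two_mul_add_sq_pos hs hsc x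
  have hid := hasDerivAt_id' x
  have hlin : HasDerivAt (fun y : ℝ => 2 * y * c) (2 * 1 * c) x := (hid.const_mul 2).mul_const c
  have hg₁ := ((hid.pow 2).sub hlin).add_const 1
  have hg₂ := ((hid.pow 2).add hlin).add_const 1
  have hlog := ((hg₁.div hg₂ h₂.ne').log (div_pos h₁ h₂).ne').const_mul c
  have hatan := ((((hid.sub_const c).div_const s).arctan).add
    (((hid.add_const c).div_const s).arctan)).const_mul ((2 * c ^ 2 - 1) / s)
  refine (((hid.const_mul 2).add hlog).add hatan).congr_deriv ?_
  have e₁ : 1 + ((x - c) / s) ^ 2 = (x ^ 2 - 2 * x * c + 1) / s ^ 2 := by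
    field_simp
    linear_combination hsc
  have e₂ : 1 + ((x + c) / s) ^ 2 = (x ^ 2 + 2 * x * c + 1) / s ^ 2 := by
    field_simp
    linear_combination hsc
  have h₁' := h₁.ne'
  have h₂' := h₂.ne'
  simp only [e₁, e₂, Pi.add_apply, Pi.sub_apply, Pi.pow_apply, Pi.div_apply]
  generalize ha : x ^ 2 - 2 * x * c + 1 = a at *
  generalize hb : x ^ 2 + 2 * x * c + 1 = b at *
  push_cast
  field_simp
  rw [← ha, ← hb]
  ring

theorem tendsto_apertureProfile_div_cube {s c : ℝ} (hs : 0 < s) (hsc : s ^ 2 + c ^ 2 = 1) :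
    Tendsto (fun x => apertureProfile s c x / x ^ 3) (nhdsWithin 0 (Set.Ioi 0)) (nhds (2 / 3)) := by
  have hcont : Continuous (fun x : ℝ =>
      (1 / (x ^ 2 - 2 * x * c + 1) + 1 / (x ^ 2 + 2 * x * c + 1)) / 3) :=
    ((continuous_const.div (by fun_prop) fun x => (one_sub_two_mul_add_sq_pos hs hsc x).ne').add
      (continuous_const.div (by fun_prop)
        fun x => (one_add_two_mul_add_sq_pos hs hsc x).ne')).div_const 3
  have hderiv := hasDerivAt_apertureProfile hs hsc
  refine HasDerivAt.lhopital_zero_nhdsGT (Eventually.of_forall hderiv)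
    (Eventually.of_forall fun x => hasDerivAt_pow 3 x) ?_ ?_ ?_ ?_
  · filter_upwards [self_mem_nhdsWithin] with x (hx : 0 < x)
    positivity
  · simpa [apertureProfile_zero] using
      (hderiv 0).continuousAt.tendsto.mono_left nhdsWithin_le_nhds
  · simpa using ((continuous_pow 3).tendsto (0 : ℝ)).mono_left nhdsWithin_le_nhds
  · have hlim := (hcont.tendsto 0).mono_left (nhdsWithin_le_nhds (s := Set.Ioi 0))
    norm_num at hlim
    refine hlim.congr' ?_
    filter_upwards [self_mem_nhdsWithin] with x (hx : 0 < x)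
    have h₁ := (one_sub_two_mul_add_sq_pos hs hsc x).ne'
    have h₂ := (one_add_two_mul_add_sq_pos hs hsc x).ne'
    push_cast
    field_simp


open Real Filter

/-- far-field limit of the per-antenna closed form of `u_θ` for a
ULA of aperture `D`: it tends to `D² sin²θ / 12` as `r → +∞` (used in
Corollary 5). -/
theorem ula_utheta_farfield_limit (D θ : ℝ) (hD : 0 < D) (hθ : θ ∈ Set.Ioo 0 π) :
    Tendsto (fun r : ℝ =>
        (r ^ 3 * sin θ ^ 2 / D) *
          (D / r
            + cos θ * Real.log ((D ^ 2 / 4 - r * D * cos θ + r ^ 2) /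
                (D ^ 2 / 4 + r * D * cos θ + r ^ 2))
            + (cos (2 * θ) / sin θ) *
                (arctan ((D - 2 * r * cos θ) / (2 * r * sin θ))
                  + arctan ((D + 2 * r * cos θ) / (2 * r * sin θ)))))
      atTop (nhds (D ^ 2 * sin θ ^ 2 / 12)) := by
  have hs : 0 < sin θ := sin_pos_of_mem_Ioo hθ
  have hsc := sin_sq_add_cos_sq θ
  have hx : Tendsto (fun r : ℝ => D / 2 / r) atTop (nhdsWithin 0 (Set.Ioi 0)) := by
    refine tendsto_nhdsWithin_iff.2 ⟨tendsto_const_nhds.div_atTop tendsto_id, ?_⟩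
    filter_upwards [eventually_gt_atTop 0] with r hr
    exact Set.mem_Ioi.2 (by positivity)
  have hlim := ((tendsto_apertureProfile_div_cube hs hsc).comp hx).const_mul
    (D ^ 2 * sin θ ^ 2 / 8)
  have hval : D ^ 2 * sin θ ^ 2 / 8 * (2 / 3) = D ^ 2 * sin θ ^ 2 / 12 := by ring
  rw [hval] at hlim
  refine hlim.congr' ?_
  filter_upwards [eventually_gt_atTop 0] with r hr
  have hquot : (D ^ 2 / 4 - r * D * cos θ + r ^ 2) / (D ^ 2 / 4 + r * D * cos θ + r ^ 2) =
      ((D / 2 / r) ^ 2 - 2 * (D / 2 / r) * cos θ + 1) /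
        ((D / 2 / r) ^ 2 + 2 * (D / 2 / r) * cos θ + 1) := by
    rw [← mul_div_mul_left _ ((D / 2 / r) ^ 2 + 2 * (D / 2 / r) * cos θ + 1)
      (pow_pos hr 2).ne']
    congr 1 <;> field_simp <;> ring
  have hsub : (D - 2 * r * cos θ) / (2 * r * sin θ) = (D / 2 / r - cos θ) / sin θ := by
    field_simp
  have hadd : (D + 2 * r * cos θ) / (2 * r * sin θ) = (D / 2 / r + cos θ) / sin θ := by
    field_simp
  have hlead : D / r = 2 * (D / 2 / r) := by ring
  have hscale : r ^ 3 * sin θ ^ 2 / D = D ^ 2 * sin θ ^ 2 / 8 / (D / 2 / r) ^ 3 := by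
    field_simp
    norm_num
  rw [hquot, hsub, hadd, hlead, hscale, cos_two_mul]
  simp only [Function.comp_apply, apertureProfile]
  ring
end

section
/- With the notation and definitions in the context, CRB_θ(N) → 3 d cos²θ / ( ρ L M π r³ (12 f_c² + B² − Δf²) sin θ ) as N → ∞. -/
open Real Filter

/-- The angle Cramér-Rao bound `CRB_θ(N)` (eq. (46)) of a uniform linear array
with `N` antennas and fixed antenna spacing `d` (aperture `D = N d`), built
from the closed-form intermediates of Theorem 1. -/
noncomputable def ulaCRBtheta (d r θ ρ L f_c Δf : ℝ) (M N : ℕ) : ℝ :=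
  let B := (M : ℝ) * Δf
  let M₁ := (M : ℝ) * f_c
  let M₂ := (M : ℝ) * f_c ^ 2 + (M : ℝ) * ((M : ℝ) ^ 2 - 1) * Δf ^ 2 / 12
  let U := (M : ℝ) * M₂ - 2 * M₁ ^ 2
  let D := (N : ℝ) * d
  let G₁ := D ^ 2 / 4 - r * D * cos θ + r ^ 2
  let G₂ := D ^ 2 / 4 + r * D * cos θ + r ^ 2
  let Ξ := arctan ((D - 2 * r * cos θ) / (2 * r * sin θ))
    + arctan ((D + 2 * r * cos θ) / (2 * r * sin θ))
  let Λ := Real.log ((Real.sqrt G₁ + D / 2 - r * cos θ) / (Real.sqrt G₂ - D / 2 - r * cos θ))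
  let uθ := (r ^ 3 * (N : ℝ) * sin θ ^ 2 / D) *
    (D / r + cos θ * Real.log (G₁ / G₂) + (cos (2 * θ) / sin θ) * Ξ)
  let ur := (N : ℝ) - uθ / r ^ 2
  let cθ := (r ^ 2 * (N : ℝ) * sin θ / D) * ((Real.sqrt G₁ - Real.sqrt G₂) / r + cos θ * Λ)
  let cr := (r * (N : ℝ) / D) * Λ - (cos θ / (r * sin θ)) * cθ
  let ε := (r ^ 2 * (N : ℝ) * sin θ / D) *
    ((1 / 2) * Real.log (G₁ / G₂) + (cos θ / sin θ) * Ξ) - (cos θ / (r * sin θ)) * uθ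
  let φ := uθ * ur - ε ^ 2
  let ψ := uθ * cr ^ 2 + ur * cθ ^ 2 - 2 * ε * cθ * cr
  ((N : ℝ) * M * M₂ * ur + U * cr ^ 2) /
    (4 * ρ * L * M₂ * ((N : ℝ) * M * M₂ * φ + U * ψ))

open Topology

theorem tendsto_quadratic_div_sq (k q : ℝ) :
    Tendsto (fun x : ℝ => (x ^ 2 / 4 + k * x + q) / x ^ 2) atTop (𝓝 (1 / 4)) := by
  have h : Tendsto (fun x : ℝ => 1 / 4 + k * x⁻¹ + q * (x⁻¹ * x⁻¹)) atTop
      (𝓝 (1 / 4 + k * 0 + q * (0 * 0))) :=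
    (tendsto_const_nhds.add (tendsto_inv_atTop_zero.const_mul k)).add
      ((tendsto_inv_atTop_zero.mul tendsto_inv_atTop_zero).const_mul q)
  simp only [mul_zero, add_zero] at h
  refine h.congr' ?_
  filter_upwards [eventually_gt_atTop 0] with x hx
  field_simp

theorem tendsto_sqrt_quadratic_div (k q : ℝ) :
    Tendsto (fun x : ℝ => √(x ^ 2 / 4 + k * x + q) / x) atTop (𝓝 (1 / 2)) := by
  have h := (tendsto_quadratic_div_sq k q).sqrt
  have h4 : √(1 / 4 : ℝ) = 1 / 2 := by
    rw [show (1 / 4 : ℝ) = (1 / 2) ^ 2 by norm_num, Real.sqrt_sq (by norm_num)]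
  rw [h4] at h
  refine h.congr' ?_
  filter_upwards [eventually_gt_atTop 0] with x hx
  rw [Real.sqrt_div' _ (sq_nonneg x), Real.sqrt_sq hx.le]

theorem eventually_quadratic_pos (k q : ℝ) :
    ∀ᶠ x : ℝ in atTop, 0 < x ^ 2 / 4 + k * x + q := by
  filter_upwards [(tendsto_quadratic_div_sq k q).eventually
    (lt_mem_nhds (by norm_num : (0 : ℝ) < 1 / 4)),
    eventually_gt_atTop 0] with x h hx
  exact (div_pos_iff_of_pos_right (pow_pos hx 2)).1 h

theorem tendsto_log_quadratic_div_quadratic (k l q : ℝ) :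
    Tendsto (fun x : ℝ => log ((x ^ 2 / 4 + k * x + q) / (x ^ 2 / 4 + l * x + q)))
      atTop (𝓝 0) := by
  have h := ((tendsto_quadratic_div_sq k q).div (tendsto_quadratic_div_sq l q)
    (by norm_num)).log (by norm_num)
  rw [div_self (by norm_num), log_one] at h
  refine h.congr' ?_
  filter_upwards [eventually_gt_atTop 0] with x hx
  simp only [Pi.div_apply]
  rw [div_div_div_cancel_right₀ (by positivity)]

theorem tendsto_sqrt_quadratic_sub_sqrt_quadratic (k l q : ℝ) :
    Tendsto (fun x : ℝ => √(x ^ 2 / 4 + k * x + q) - √(x ^ 2 / 4 + l * x + q))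
      atTop (𝓝 (k - l)) := by
  have h := (tendsto_const_nhds (x := k - l)).div
    ((tendsto_sqrt_quadratic_div k q).add (tendsto_sqrt_quadratic_div l q)) (by norm_num)
  rw [show (k - l) / (1 / 2 + 1 / 2) = k - l by norm_num] at h
  refine h.congr' ?_
  filter_upwards [eventually_gt_atTop 0, eventually_quadratic_pos k q,
    eventually_quadratic_pos l q] with x hx h₁ h₂
  have e₁ := Real.sq_sqrt h₁.le
  have e₂ := Real.sq_sqrt h₂.le
  have p₁ := Real.sqrt_pos.2 h₁
  have p₂ := Real.sqrt_pos.2 h₂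
  simp only [Pi.div_apply]
  rw [← add_div, div_div_eq_mul_div, div_eq_iff (by positivity)]
  linear_combination e₂ - e₁

theorem tendsto_arctan_affine_div {b : ℝ} (a : ℝ) (hb : 0 < b) :
    Tendsto (fun x : ℝ => arctan ((x + a) / b)) atTop (𝓝 (π / 2)) :=
  (tendsto_arctan_atTop.mono_right nhdsWithin_le_nhds).comp
    ((tendsto_atTop_add_const_right _ a tendsto_id).atTop_div_const hb)

theorem tendsto_log_div_sqrt_of_tendsto_div_sq {f : ℝ → ℝ} {K : ℝ} (hK : 0 < K)
    (hf : Tendsto (fun x => f x / x ^ 2) atTop (𝓝 K)) :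
    Tendsto (fun x => log (f x) / √x) atTop (𝓝 0) := by
  have h₁ : Tendsto (fun x : ℝ => log x / √x) atTop (𝓝 0) := by
    simp only [Real.sqrt_eq_rpow]
    exact (isLittleO_log_rpow_atTop (by norm_num : (0 : ℝ) < 1 / 2)).tendsto_div_nhds_zero
  have h₂ := ((hf.log hK.ne').div_atTop tendsto_sqrt_atTop).add (h₁.const_mul 2)
  rw [mul_zero, add_zero] at h₂
  refine h₂.congr' ?_
  filter_upwards [eventually_gt_atTop 0, hf.eventually (lt_mem_nhds hK)] with x hx hfx
  have hfx' := (div_pos_iff_of_pos_right (pow_pos hx 2)).1 hfx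
  rw [log_div hfx'.ne' (by positivity), log_pow]
  push_cast
  ring

theorem tendsto_log_sqrt_quotient_div_sqrt {m q : ℝ} (hq : m ^ 2 < q) :
    Tendsto (fun x : ℝ => log ((√(x ^ 2 / 4 + (-m) * x + q) + x / 2 - m) /
      (√(x ^ 2 / 4 + m * x + q) - x / 2 - m)) / √x) atTop (𝓝 0) := by
  have hq' : 0 < q - m ^ 2 := by linarith
  have hm : Tendsto (fun x : ℝ => m / x) atTop (𝓝 0) :=
    tendsto_const_nhds.div_atTop tendsto_id
  have h : Tendsto (fun x : ℝ => (√(x ^ 2 / 4 + (-m) * x + q) / x + 1 / 2 - m / x) *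
      (√(x ^ 2 / 4 + m * x + q) / x + 1 / 2 + m / x) / (q - m ^ 2)) atTop
      (𝓝 ((1 / 2 + 1 / 2 - 0) * (1 / 2 + 1 / 2 + 0) / (q - m ^ 2))) :=
    ((((tendsto_sqrt_quadratic_div (-m) q).add_const _).sub hm).mul
      (((tendsto_sqrt_quadratic_div m q).add_const _).add hm)).div_const _
  refine tendsto_log_div_sqrt_of_tendsto_div_sq (by norm_num; linarith) (h.congr' ?_)
  filter_upwards [eventually_gt_atTop 0, eventually_gt_atTop (-2 * m),
    eventually_quadratic_pos m q] with x hx hxm hpos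
  have e := Real.sq_sqrt hpos.le
  have hs : 0 < √(x ^ 2 / 4 + m * x + q) + x / 2 + m := by
    have := Real.sqrt_nonneg (x ^ 2 / 4 + m * x + q)
    linarith
  have key : √(x ^ 2 / 4 + m * x + q) - x / 2 - m =
      (q - m ^ 2) / (√(x ^ 2 / 4 + m * x + q) + x / 2 + m) := by
    rw [eq_div_iff hs.ne']
    linear_combination e
  rw [key]
  field_simp

/-- The limit of the bound in terms of the limits of its transcendental ingredients:
`G` stands for `log (G₁ / G₂)`, `X` for `Ξ`, `S` for `√G₁ - √G₂` and `l` for `Λ`. -/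
theorem tendsto_crb_quotient {ι : Type*} {F : Filter ι} {n G X S l : ι → ℝ}
    {d r θ m₂ m U C ℓ : ℝ} (hd : 0 < d) (hr : 0 < r) (hs : 0 < sin θ)
    (hm : 0 < m) (hm₂ : 0 < m₂) (hC : 0 < C)
    (hn : Tendsto n F atTop) (hG : Tendsto G F (𝓝 0)) (hX : Tendsto X F (𝓝 π))
    (hS : Tendsto S F (𝓝 ℓ)) (hl : Tendsto (fun i => l i / √(n i)) F (𝓝 0)) :
    Tendsto (fun i =>
      let N := n i
      let D := N * d
      let uθ := (r ^ 3 * N * sin θ ^ 2 / D) *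
        (D / r + cos θ * G i + (cos (2 * θ) / sin θ) * X i)
      let ur := N - uθ / r ^ 2
      let cθ := (r ^ 2 * N * sin θ / D) * (S i / r + cos θ * l i)
      let cr := (r * N / D) * l i - (cos θ / (r * sin θ)) * cθ
      let ε := (r ^ 2 * N * sin θ / D) *
        ((1 / 2) * G i + (cos θ / sin θ) * X i) - (cos θ / (r * sin θ)) * uθ
      let φ := uθ * ur - ε ^ 2
      let ψ := uθ * cr ^ 2 + ur * cθ ^ 2 - 2 * ε * cθ * cr
      (N * m * m₂ * ur + U * cr ^ 2) / (C * m₂ * (N * m * m₂ * φ + U * ψ))) F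
      (𝓝 (d * cos θ ^ 2 / (C * m₂ * π * r ^ 3 * sin θ))) := by
  set s := sin θ
  set c := cos θ
  have hsc : s ^ 2 + c ^ 2 = 1 := sin_sq_add_cos_sq θ
  have hcos2 : cos (2 * θ) = c ^ 2 - s ^ 2 := cos_two_mul' θ
  rw [hcos2]
  have hinv : Tendsto (fun i => (n i)⁻¹) F (𝓝 0) := tendsto_inv_atTop_zero.comp hn
  have hsqrt : Tendsto (fun i => √(n i)) F atTop := tendsto_sqrt_atTop.comp hn
  -- remainders of `u_θ` and `ε` after removing their linear parts
  let a : ι → ℝ := fun i => r ^ 3 * s ^ 2 / d * (c * G i + (c ^ 2 - s ^ 2) / s * X i)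
  have ha : Tendsto a F (𝓝 (r ^ 3 * s ^ 2 / d * (c * 0 + (c ^ 2 - s ^ 2) / s * π))) :=
    ((hG.const_mul c).add (hX.const_mul _)).const_mul _
  let e : ι → ℝ := fun i =>
    r ^ 2 * s / d * (1 / 2 * G i + c / s * X i) - c / (r * s) * a i
  have he : Tendsto e F (𝓝 (r ^ 2 * s / d * (1 / 2 * 0 + c / s * π) -
      c / (r * s) * (r ^ 3 * s ^ 2 / d * (c * 0 + (c ^ 2 - s ^ 2) / s * π)))) :=
    (((hG.const_mul _).add (hX.const_mul _)).const_mul _).sub (ha.const_mul _)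
  -- `c_θ` and `c_r` divided by `√N`
  let p : ι → ℝ := fun i => r ^ 2 * s / d * (S i / √(n i) / r + c * (l i / √(n i)))
  have hp : Tendsto p F (𝓝 0) := by
    have h := ((((hS.div_atTop hsqrt).div_const r).add (hl.const_mul c)).const_mul
      (r ^ 2 * s / d))
    simpa using h
  let t : ι → ℝ := fun i => r / d * (l i / √(n i)) - c / (r * s) * p i
  have ht : Tendsto t F (𝓝 0) := by
    simpa using (hl.const_mul (r / d)).sub (hp.const_mul (c / (r * s)))
  let v : ι → ℝ := fun i => r ^ 2 * s ^ 2 + a i * (n i)⁻¹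
  have hv : Tendsto v F (𝓝 (r ^ 2 * s ^ 2)) := by
    simpa using (ha.mul hinv).const_add (r ^ 2 * s ^ 2)
  let w : ι → ℝ := fun i => c ^ 2 - a i / r ^ 2 * (n i)⁻¹
  have hw : Tendsto w F (𝓝 (c ^ 2)) := by
    simpa using ((ha.div_const (r ^ 2)).mul hinv).const_sub (c ^ 2)
  let z : ι → ℝ := fun i => -(c * r * s) + e i * (n i)⁻¹
  have hz : Tendsto z F (𝓝 (-(c * r * s))) := by
    simpa using (he.mul hinv).const_add (-(c * r * s))
  let f : ι → ℝ := fun i => a i * (c ^ 2 - s ^ 2) + 2 * c * r * s * e i -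
    (a i ^ 2 / r ^ 2 + e i ^ 2) * (n i)⁻¹
  have hf : Tendsto f F (𝓝 (r ^ 3 * π * s / d)) := by
    have h := ((ha.mul_const (c ^ 2 - s ^ 2)).add (he.const_mul (2 * c * r * s))).sub
      ((((ha.pow 2).div_const (r ^ 2)).add (he.pow 2)).mul hinv)
    convert h using 2
    simp only [mul_zero, zero_add, sub_zero]
    field_simp
    linear_combination (c ^ 2 - s ^ 2 - 1) * hsc
  let g : ι → ℝ := fun i => v i * t i ^ 2 + w i * p i ^ 2 - 2 * z i * p i * t i
  have hg : Tendsto g F (𝓝 0) := by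
    have h := ((hv.mul (ht.pow 2)).add (hw.mul (hp.pow 2))).sub
      (((hz.const_mul 2).mul hp).mul ht)
    simpa using h
  have hnum : Tendsto (fun i => m * m₂ * w i + U * (t i ^ 2 * (n i)⁻¹)) F
      (𝓝 (m * m₂ * c ^ 2)) := by
    simpa using (hw.const_mul (m * m₂)).add (((ht.pow 2).mul hinv).const_mul U)
  have hden : Tendsto (fun i => C * m₂ * (m * m₂ * f i + U * g i)) F
      (𝓝 (C * m₂ * (m * m₂ * (r ^ 3 * π * s / d)))) := by
    simpa using ((hf.const_mul (m * m₂)).add (hg.const_mul U)).const_mul (C * m₂)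
  have hpi := Real.pi_pos
  have hlim := hnum.div hden (by positivity)
  have hval : m * m₂ * c ^ 2 / (C * m₂ * (m * m₂ * (r ^ 3 * π * s / d))) =
      d * c ^ 2 / (C * m₂ * π * r ^ 3 * s) := by
    field_simp
  rw [hval] at hlim
  refine hlim.congr' ?_
  filter_upwards [hn.eventually_gt_atTop 0] with i hi
  have hq : 0 < √(n i) := Real.sqrt_pos.2 hi
  have hq2 : √(n i) ^ 2 = n i := Real.sq_sqrt hi.le
  have huθ : (r ^ 3 * n i * s ^ 2 / (n i * d)) *
      (n i * d / r + c * G i + ((c ^ 2 - s ^ 2) / s) * X i) = n i * v i := by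
    simp only [v, a]
    field_simp
    ring
  have hur : n i - n i * v i / r ^ 2 = n i * w i := by
    simp only [v, w]
    field_simp
    linear_combination (-(n i * r ^ 2)) * hsc
  have hcθ : (r ^ 2 * n i * s / (n i * d)) * (S i / r + c * l i) = √(n i) * p i := by
    simp only [p]
    field_simp
  have hcr : (r * n i / (n i * d)) * l i - (c / (r * s)) * (√(n i) * p i) =
      √(n i) * t i := by
    simp only [t]
    field_simp
  have hε : (r ^ 2 * n i * s / (n i * d)) * ((1 / 2) * G i + (c / s) * X i) -
      (c / (r * s)) * (n i * v i) = n i * z i := by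
    simp only [z, e, v]
    field_simp
    ring
  have hφ : n i * v i * (n i * w i) - (n i * z i) ^ 2 = n i * f i := by
    simp only [v, w, z, f]
    field_simp
    ring
  have hψ : n i * v i * (√(n i) * t i) ^ 2 + n i * w i * (√(n i) * p i) ^ 2 -
      2 * (n i * z i) * (√(n i) * p i) * (√(n i) * t i) = n i ^ 2 * g i := by
    simp only [g]
    linear_combination (n i * (v i * t i ^ 2 + w i * p i ^ 2 - 2 * z i * p i * t i)) * hq2
  simp only [Pi.div_apply]
  rw [huθ, hur, hcθ, hcr, hε, hφ, hψ, mul_pow, hq2,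
    ← mul_div_mul_left _ _ (pow_pos hi 2).ne']
  congr 1
  · field_simp
  · ring

/-- Corollary 3, angle part: with fixed antenna spacing `d`,
`CRB_θ(N) → 3 d cos²θ / (ρ L M π r³ (12 f_c² + B² − Δf²) sin θ)` as `N → ∞`. -/
theorem ula_crb_theta_fixed_spacing_limit (d r θ ρ L f_c Δf : ℝ) (M : ℕ)
    (hd : 0 < d) (hr : 0 < r) (hθ : θ ∈ Set.Ioo 0 π)
    (hρ : 0 < ρ) (hL : 0 < L) (hfc : 0 < f_c) (hΔf : 0 < Δf) (hM : 0 < M) :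
    Tendsto (fun N : ℕ => ulaCRBtheta d r θ ρ L f_c Δf M N) atTop
      (nhds (3 * d * cos θ ^ 2 /
        (ρ * L * M * π * r ^ 3 * (12 * f_c ^ 2 + ((M : ℝ) * Δf) ^ 2 - Δf ^ 2) * sin θ))) := by
  have hs : 0 < sin θ := sin_pos_of_mem_Ioo hθ
  have hsc : sin θ ^ 2 + cos θ ^ 2 = 1 := sin_sq_add_cos_sq θ
  have hM1 : (1 : ℝ) ≤ M := by exact_mod_cast hM
  have hM₂ : 0 < (M : ℝ) * f_c ^ 2 + (M : ℝ) * ((M : ℝ) ^ 2 - 1) * Δf ^ 2 / 12 := by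
    have h1 : 0 ≤ (M : ℝ) ^ 2 - 1 := by nlinarith
    positivity
  have hb : 0 < 2 * r * sin θ := by positivity
  have hq : (r * cos θ) ^ 2 < r ^ 2 := by nlinarith [mul_pos (pow_pos hr 2) (pow_pos hs 2)]
  have hn : Tendsto (fun N : ℕ => (N : ℝ)) atTop atTop := tendsto_natCast_atTop_atTop
  have hD : Tendsto (fun N : ℕ => (N : ℝ) * d) atTop atTop := hn.atTop_mul_const hd
  have hΞ := (tendsto_arctan_affine_div (-(2 * r * cos θ)) hb).add
    (tendsto_arctan_affine_div (2 * r * cos θ) hb)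
  rw [add_halves] at hΞ
  have hΛ := ((tendsto_log_sqrt_quotient_div_sqrt hq).comp hD).mul_const √d
  rw [zero_mul] at hΛ
  have hΛ' := hΛ.congr (f₂ := fun N : ℕ => log ((√(((N : ℝ) * d) ^ 2 / 4 +
      (-(r * cos θ)) * ((N : ℝ) * d) + r ^ 2) + (N : ℝ) * d / 2 - r * cos θ) /
      (√(((N : ℝ) * d) ^ 2 / 4 + (r * cos θ) * ((N : ℝ) * d) + r ^ 2) -
        (N : ℝ) * d / 2 - r * cos θ)) / √(N : ℝ)) (fun N => by
    have hd' : √d ≠ 0 := (Real.sqrt_pos.2 hd).ne'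
    simp only [Function.comp_apply]
    rw [Real.sqrt_mul (Nat.cast_nonneg N), div_mul_eq_mul_div, mul_div_mul_right _ _ hd'])
  have key := tendsto_crb_quotient
    (U := (M : ℝ) * ((M : ℝ) * f_c ^ 2 + (M : ℝ) * ((M : ℝ) ^ 2 - 1) * Δf ^ 2 / 12) -
      2 * ((M : ℝ) * f_c) ^ 2) hd hr hs (by linarith : (0 : ℝ) < M) hM₂
    (by positivity : 0 < 4 * ρ * L) hn
    ((tendsto_log_quadratic_div_quadratic (-(r * cos θ)) (r * cos θ) (r ^ 2)).comp hD)
    (hΞ.comp hD)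
    ((tendsto_sqrt_quadratic_sub_sqrt_quadratic (-(r * cos θ)) (r * cos θ) (r ^ 2)).comp hD)
    hΛ'
  convert key using 2 with N
  · have e₁ : ((N : ℝ) * d) ^ 2 / 4 - r * ((N : ℝ) * d) * cos θ + r ^ 2 =
        ((N : ℝ) * d) ^ 2 / 4 + (-(r * cos θ)) * ((N : ℝ) * d) + r ^ 2 := by ring
    have e₂ : ((N : ℝ) * d) ^ 2 / 4 + r * ((N : ℝ) * d) * cos θ + r ^ 2 =
        ((N : ℝ) * d) ^ 2 / 4 + (r * cos θ) * ((N : ℝ) * d) + r ^ 2 := by ring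
    simp only [ulaCRBtheta, Function.comp_apply, e₁, e₂, ← sub_eq_add_neg]
  · have e : (M : ℝ) * f_c ^ 2 + (M : ℝ) * ((M : ℝ) ^ 2 - 1) * Δf ^ 2 / 12 =
        M * (12 * f_c ^ 2 + ((M : ℝ) * Δf) ^ 2 - Δf ^ 2) / 12 := by ring
    have hW : 0 < 12 * f_c ^ 2 + ((M : ℝ) * Δf) ^ 2 - Δf ^ 2 := by
      nlinarith [mul_nonneg (by nlinarith : 0 ≤ (M : ℝ) ^ 2 - 1) (sq_nonneg Δf), pow_pos hfc 2]
    rw [e]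
    field_simp
    ring
end

section
/- With the notation and definitions in the context, CRB_r(N) → 3 d sin θ / ( ρ L M π r (12 f_c² + B² − Δf²) ) as N → ∞. -/
open Real Filter

/-- The distance Cramér-Rao bound `CRB_r(N)` (eq. (47)) of a uniform linear
array with `N` antennas and fixed antenna spacing `d` (aperture `D = N d`),
built from the closed-form intermediates of Theorem 1. -/
noncomputable def ulaCRBr (d r θ ρ L f_c Δf : ℝ) (M N : ℕ) : ℝ :=
  let M₁ := (M : ℝ) * f_c
  let M₂ := (M : ℝ) * f_c ^ 2 + (M : ℝ) * ((M : ℝ) ^ 2 - 1) * Δf ^ 2 / 12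
  let U := (M : ℝ) * M₂ - 2 * M₁ ^ 2
  let D := (N : ℝ) * d
  let G₁ := D ^ 2 / 4 - r * D * cos θ + r ^ 2
  let G₂ := D ^ 2 / 4 + r * D * cos θ + r ^ 2
  let Ξ := arctan ((D - 2 * r * cos θ) / (2 * r * sin θ))
    + arctan ((D + 2 * r * cos θ) / (2 * r * sin θ))
  let Λ := Real.log ((Real.sqrt G₁ + D / 2 - r * cos θ) / (Real.sqrt G₂ - D / 2 - r * cos θ))
  let uθ := (r ^ 3 * (N : ℝ) * sin θ ^ 2 / D) *
    (D / r + cos θ * Real.log (G₁ / G₂) + (cos (2 * θ) / sin θ) * Ξ)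
  let ur := (N : ℝ) - uθ / r ^ 2
  let cθ := (r ^ 2 * (N : ℝ) * sin θ / D) * ((Real.sqrt G₁ - Real.sqrt G₂) / r + cos θ * Λ)
  let cr := (r * (N : ℝ) / D) * Λ - (cos θ / (r * sin θ)) * cθ
  let ε := (r ^ 2 * (N : ℝ) * sin θ / D) *
    ((1 / 2) * Real.log (G₁ / G₂) + (cos θ / sin θ) * Ξ) - (cos θ / (r * sin θ)) * uθ
  let φ := uθ * ur - ε ^ 2
  let ψ := uθ * cr ^ 2 + ur * cθ ^ 2 - 2 * ε * cθ * cr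
  ((N : ℝ) * M * M₂ * uθ + U * cθ ^ 2) /
    (4 * ρ * L * M₂ * ((N : ℝ) * M * M₂ * φ + U * ψ))

theorem tendsto_log_quadratic_div_quadratic_atTop (p q : ℝ) :
    Tendsto (fun x : ℝ => Real.log ((x ^ 2 / 4 - p * x + q) / (x ^ 2 / 4 + p * x + q)))
      atTop (nhds 0) := by
  have hinv : Tendsto (fun x : ℝ => x⁻¹) atTop (nhds 0) := tendsto_inv_atTop_zero
  have hquot : Tendsto (fun x : ℝ => (1 / 4 - p * x⁻¹ + q * x⁻¹ ^ 2) /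
      (1 / 4 + p * x⁻¹ + q * x⁻¹ ^ 2)) atTop (nhds 1) := by
    have hnum := ((hinv.const_mul p).const_sub (1 / 4)).add ((hinv.pow 2).const_mul q)
    have hden := ((hinv.const_mul p).const_add (1 / 4)).add ((hinv.pow 2).const_mul q)
    have h := hnum.div hden (by norm_num)
    norm_num at h
    simpa [Pi.div_def] using h
  have hlog := hquot.log one_ne_zero
  rw [Real.log_one] at hlog
  refine hlog.congr' ?_
  filter_upwards [eventually_gt_atTop 0] with x hx
  have h₁ : x ^ 2 / 4 - p * x + q = x ^ 2 * (1 / 4 - p * x⁻¹ + q * x⁻¹ ^ 2) := by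
    field_simp
  have h₂ : x ^ 2 / 4 + p * x + q = x ^ 2 * (1 / 4 + p * x⁻¹ + q * x⁻¹ ^ 2) := by
    field_simp
  rw [h₁, h₂, mul_div_mul_left _ _ (by positivity)]

theorem tendsto_arctan_sub_add_arctan_add_atTop (a : ℝ) {b : ℝ} (hb : 0 < b) :
    Tendsto (fun x : ℝ => arctan ((x - a) / b) + arctan ((x + a) / b)) atTop (nhds π) := by
  have h (c : ℝ) : Tendsto (fun x : ℝ => arctan ((x + c) / b)) atTop (nhds (π / 2)) :=
    (Real.tendsto_arctan_atTop.mono_right nhdsWithin_le_nhds).comp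
      ((tendsto_atTop_add_const_right atTop c tendsto_id).atTop_div_const hb)
  simpa [sub_eq_add_neg] using (h (-a)).add (h a)

theorem sqrt_quadratic_mem_Icc {r x t : ℝ} (hr : 0 < r) (hx : 2 * r ≤ x)
    (ht : t ∈ Set.Icc (-1 : ℝ) 1) :
    Real.sqrt (x ^ 2 / 4 + r * x * t + r ^ 2) ∈ Set.Icc (x / 2 - r) (x / 2 + r) := by
  obtain ⟨ht₁, ht₂⟩ := ht
  have hrx : 0 < r * x := mul_pos hr (by linarith)
  refine ⟨Real.le_sqrt_of_sq_le ?_, Real.sqrt_le_iff.mpr ⟨by linarith, ?_⟩⟩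
  · nlinarith
  · nlinarith

theorem tendsto_sqrt_sub_sqrt_div_sqrt_atTop {r t : ℝ} (hr : 0 < r)
    (ht : t ∈ Set.Icc (-1 : ℝ) 1) :
    Tendsto (fun x : ℝ => (Real.sqrt (x ^ 2 / 4 - r * x * t + r ^ 2) -
      Real.sqrt (x ^ 2 / 4 + r * x * t + r ^ 2)) / Real.sqrt x) atTop (nhds 0) := by
  have hlim : Tendsto (fun x : ℝ => 2 * r / Real.sqrt x) atTop (nhds 0) :=
    tendsto_const_nhds.div_atTop Real.tendsto_sqrt_atTop
  refine squeeze_zero_norm' ?_ hlim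
  filter_upwards [eventually_ge_atTop (2 * r)] with x hx
  have h₁ := sqrt_quadratic_mem_Icc hr hx (t := -t) ⟨by linarith [ht.2], by linarith [ht.1]⟩
  have h₂ := sqrt_quadratic_mem_Icc hr hx ht
  rw [mul_neg, ← sub_eq_add_neg] at h₁
  rw [Real.norm_eq_abs, abs_div, abs_of_nonneg (Real.sqrt_nonneg x)]
  gcongr
  rw [abs_le]
  constructor <;> linarith [h₁.1, h₁.2, h₂.1, h₂.2]

theorem tendsto_log_mul_sq_div_sqrt_atTop {K : ℝ} (hK : 0 < K) :
    Tendsto (fun x : ℝ => Real.log (K * x ^ 2) / Real.sqrt x) atTop (nhds 0) := by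
  have hlog : Tendsto (fun x : ℝ => Real.log x / Real.sqrt x) atTop (nhds 0) := by
    simpa [Real.sqrt_eq_rpow] using
      (isLittleO_log_rpow_atTop (by norm_num : (0 : ℝ) < 1 / 2)).tendsto_div_nhds_zero
  have hconst : Tendsto (fun x : ℝ => Real.log K / Real.sqrt x) atTop (nhds 0) :=
    tendsto_const_nhds.div_atTop Real.tendsto_sqrt_atTop
  have h := hconst.add (hlog.const_mul 2)
  rw [mul_zero, add_zero] at h
  refine h.congr' ?_
  filter_upwards [eventually_gt_atTop 0] with x hx
  rw [Real.log_mul hK.ne' (by positivity), Real.log_pow]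
  push_cast
  ring

theorem tendsto_log_sqrt_ratio_div_sqrt_atTop {r θ : ℝ} (hr : 0 < r) (hs : 0 < sin θ) :
    Tendsto (fun x : ℝ => Real.log
      ((Real.sqrt (x ^ 2 / 4 - r * x * cos θ + r ^ 2) + x / 2 - r * cos θ) /
        (Real.sqrt (x ^ 2 / 4 + r * x * cos θ + r ^ 2) - x / 2 - r * cos θ)) / Real.sqrt x)
      atTop (nhds 0) := by
  have hrs : 0 < r * sin θ := mul_pos hr hs
  refine squeeze_zero' ?_ ?_
    (tendsto_log_mul_sq_div_sqrt_atTop (K := 4 / (r * sin θ) ^ 2) (by positivity))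
  all_goals
    filter_upwards [eventually_ge_atTop (4 * r)] with x hx
    have ht : cos θ ∈ Set.Icc (-1 : ℝ) 1 := cos_mem_Icc θ
    have ht' : -cos θ ∈ Set.Icc (-1 : ℝ) 1 := ⟨by linarith [ht.2], by linarith [ht.1]⟩
    have h₁ := sqrt_quadratic_mem_Icc hr (by linarith : 2 * r ≤ x) ht'
    have h₂ := sqrt_quadratic_mem_Icc hr (by linarith : 2 * r ≤ x) ht
    rw [mul_neg, ← sub_eq_add_neg] at h₁
    have hrx : 0 < r * x := mul_pos hr (by linarith)
    have hG₂ : Real.sqrt (x ^ 2 / 4 + r * x * cos θ + r ^ 2) ^ 2 =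
        x ^ 2 / 4 + r * x * cos θ + r ^ 2 :=
      Real.sq_sqrt (by nlinarith [ht.1, sq_nonneg (x / 2 - r)])
    set a := Real.sqrt (x ^ 2 / 4 - r * x * cos θ + r ^ 2)
    set b := Real.sqrt (x ^ 2 / 4 + r * x * cos θ + r ^ 2)
    have hc₁ : -r ≤ r * cos θ := by nlinarith [ht.1]
    have hc₂ : r * cos θ ≤ r := by nlinarith [ht.2]
    have hsum : 0 < b + x / 2 + r * cos θ := by linarith [h₂.1]
    have hprod : (b - x / 2 - r * cos θ) * (b + x / 2 + r * cos θ) = (r * sin θ) ^ 2 := by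
      linear_combination hG₂ - r ^ 2 * sin_sq_add_cos_sq θ
    have hdiff : b - x / 2 - r * cos θ ≠ 0 := by
      intro h0
      rw [h0, zero_mul] at hprod
      exact (pow_pos hrs 2).ne hprod
    have hratio : (a + x / 2 - r * cos θ) / (b - x / 2 - r * cos θ) =
        (a + x / 2 - r * cos θ) * (b + x / 2 + r * cos θ) / (r * sin θ) ^ 2 := by
      rw [← hprod, mul_div_mul_right _ _ hsum.ne']
    rw [hratio]
  · refine div_nonneg (Real.log_nonneg ?_) (Real.sqrt_nonneg x)
    rw [one_le_div (by positivity)]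
    have hs1 : r * sin θ ≤ r := by nlinarith [sin_le_one θ]
    have hA : r ≤ a + x / 2 - r * cos θ := by linarith [h₁.1]
    have hB : r ≤ b + x / 2 + r * cos θ := by linarith [h₂.1]
    rw [sq]
    exact mul_le_mul (hs1.trans hA) (hs1.trans hB) hrs.le (hr.le.trans hA)
  · have hA : 0 < a + x / 2 - r * cos θ := by linarith [h₁.1]
    refine div_le_div_of_nonneg_right (Real.log_le_log (by positivity) ?_) (Real.sqrt_nonneg x)
    rw [div_mul_eq_mul_div]
    refine div_le_div_of_nonneg_right ?_ (sq_nonneg _)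
    calc (a + x / 2 - r * cos θ) * (b + x / 2 + r * cos θ)
        ≤ (2 * x) * (2 * x) := by
          apply mul_le_mul _ _ hsum.le (by linarith) <;> linarith [h₁.2, h₂.2]
      _ = 4 * x ^ 2 := by ring

/-- The limit of a quotient of information terms in which `u`, `v`, `e` grow at most linearly, the
coupling terms `p`, `q` grow slower than a square root, and `u * v - e ^ 2` grows linearly. -/
theorem tendsto_crb_quotient_s17 {ι : Type*} {l : Filter ι} {n u v e p q : ι → ℝ} {a b c φ₀ : ℝ}
    (K₁ K₂ U C : ℝ) (hn : Tendsto n l atTop)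
    (hu : Tendsto (fun i => u i / n i) l (nhds a)) (hv : Tendsto (fun i => v i / n i) l (nhds b))
    (he : Tendsto (fun i => e i / n i) l (nhds c))
    (hp : Tendsto (fun i => p i / Real.sqrt (n i)) l (nhds 0))
    (hq : Tendsto (fun i => q i / Real.sqrt (n i)) l (nhds 0))
    (hφ : Tendsto (fun i => (u i * v i - e i ^ 2) / n i) l (nhds φ₀))
    (h0 : C * (K₁ * K₂ * φ₀) ≠ 0) :
    Tendsto (fun i => (n i * K₁ * K₂ * u i + U * p i ^ 2) /
      (C * (n i * K₁ * K₂ * (u i * v i - e i ^ 2) +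
        U * (u i * q i ^ 2 + v i * p i ^ 2 - 2 * e i * p i * q i)))) l
      (nhds (K₁ * K₂ * a / (C * (K₁ * K₂ * φ₀)))) := by
  have hinv : Tendsto (fun i => (n i)⁻¹) l (nhds 0) := tendsto_inv_atTop_zero.comp hn
  have hnum := (hu.const_mul (K₁ * K₂)).add (((hp.pow 2).mul hinv).const_mul U)
  have hψ := ((hu.mul (hq.pow 2)).add (hv.mul (hp.pow 2))).sub (((he.const_mul 2).mul hp).mul hq)
  have hden := ((hφ.const_mul (K₁ * K₂)).add (hψ.const_mul U)).const_mul C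
  have h := hnum.div hden (by simpa using h0)
  have hlim : (K₁ * K₂ * a + U * ((0 : ℝ) ^ 2 * 0)) /
      (C * (K₁ * K₂ * φ₀ + U * (a * 0 ^ 2 + b * 0 ^ 2 - 2 * c * 0 * 0))) =
      K₁ * K₂ * a / (C * (K₁ * K₂ * φ₀)) := by ring
  rw [hlim] at h
  refine h.congr' ?_
  filter_upwards [hn.eventually_gt_atTop 0] with i hi
  obtain ⟨s, hs, hns⟩ : ∃ s : ℝ, 0 < s ∧ n i = s ^ 2 :=
    ⟨Real.sqrt (n i), Real.sqrt_pos.mpr hi, (Real.sq_sqrt hi.le).symm⟩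
  simp only [Pi.div_apply, hns, Real.sqrt_sq hs.le]
  rw [← mul_div_mul_left _ _ (pow_pos hs 4).ne']
  congr 1 <;> field_simp

/-- Corollary 3, distance part: with fixed antenna spacing `d`,
`CRB_r(N) → 3 d sin θ / (ρ L M π r (12 f_c² + B² − Δf²))` as `N → ∞`. -/
theorem ula_crb_r_fixed_spacing_limit (d r θ ρ L f_c Δf : ℝ) (M : ℕ)
    (hd : 0 < d) (hr : 0 < r) (hθ : θ ∈ Set.Ioo 0 π)
    (hρ : 0 < ρ) (hL : 0 < L) (hfc : 0 < f_c) (hΔf : 0 < Δf) (hM : 0 < M) :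
    Tendsto (fun N : ℕ => ulaCRBr d r θ ρ L f_c Δf M N) atTop
      (nhds (3 * d * sin θ /
        (ρ * L * M * π * r * (12 * f_c ^ 2 + ((M : ℝ) * Δf) ^ 2 - Δf ^ 2)))) := by
  have hs : 0 < sin θ := sin_pos_of_mem_Ioo hθ
  have hM₁ : (1 : ℝ) ≤ M := by exact_mod_cast hM
  have hM₂ : 0 < 12 * f_c ^ 2 + ((M : ℝ) ^ 2 - 1) * Δf ^ 2 := by
    have : 0 ≤ (M : ℝ) ^ 2 - 1 := by nlinarith
    positivity
  have hn : Tendsto (fun N : ℕ => (N : ℝ)) atTop atTop := tendsto_natCast_atTop_atTop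
  have hD : Tendsto (fun N : ℕ => (N : ℝ) * d) atTop atTop := hn.atTop_mul_const hd
  have hn0 : ∀ᶠ N : ℕ in atTop, (0 : ℝ) < N := hn.eventually_gt_atTop 0
  have hinv : Tendsto (fun N : ℕ => (N : ℝ)⁻¹) atTop (nhds 0) := tendsto_inv_atTop_zero.comp hn
  have rescale {f : ℝ → ℝ} (hf : Tendsto (fun x => f x / Real.sqrt x) atTop (nhds 0)) :
      Tendsto (fun N : ℕ => f (N * d) / Real.sqrt N) atTop (nhds 0) := by
    have h := (hf.comp hD).mul_const (Real.sqrt d)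
    rw [zero_mul] at h
    refine h.congr' ?_
    filter_upwards [hn0] with N hN
    have : Real.sqrt d ≠ 0 := (Real.sqrt_pos.mpr hd).ne'
    simp only [Function.comp_apply, Real.sqrt_mul hN.le]
    field_simp
  have hlog := (tendsto_log_quadratic_div_quadratic_atTop (r * cos θ) (r ^ 2)).comp hD
  have hΞ := (tendsto_arctan_sub_add_arctan_add_atTop (2 * r * cos θ)
    (by positivity : 0 < 2 * r * sin θ)).comp hD
  have hΔ := rescale (tendsto_sqrt_sub_sqrt_div_sqrt_atTop hr (cos_mem_Icc θ))
  have hΛ := rescale (tendsto_log_sqrt_ratio_div_sqrt_atTop hr hs)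
  have hlg : Tendsto (fun N : ℕ => Real.log
      (((N * d) ^ 2 / 4 - r * (N * d) * cos θ + r ^ 2) /
        ((N * d) ^ 2 / 4 + r * (N * d) * cos θ + r ^ 2))) atTop (nhds 0) := by
    refine hlog.congr fun N => ?_
    simp only [Function.comp_apply, mul_right_comm r (cos θ)]
  simp only [Function.comp_def] at hΞ
  set lg : ℕ → ℝ := fun N => Real.log
    (((N * d) ^ 2 / 4 - r * (N * d) * cos θ + r ^ 2) /
      ((N * d) ^ 2 / 4 + r * (N * d) * cos θ + r ^ 2))
  set Ξ : ℕ → ℝ := fun N => arctan ((N * d - 2 * r * cos θ) / (2 * r * sin θ)) +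
    arctan ((N * d + 2 * r * cos θ) / (2 * r * sin θ))
  set δ : ℕ → ℝ := fun N => Real.sqrt ((N * d) ^ 2 / 4 - r * (N * d) * cos θ + r ^ 2) -
    Real.sqrt ((N * d) ^ 2 / 4 + r * (N * d) * cos θ + r ^ 2)
  set Λ : ℕ → ℝ := fun N => Real.log
    ((Real.sqrt ((N * d) ^ 2 / 4 - r * (N * d) * cos θ + r ^ 2) + N * d / 2 - r * cos θ) /
      (Real.sqrt ((N * d) ^ 2 / 4 + r * (N * d) * cos θ + r ^ 2) - N * d / 2 - r * cos θ))
  replace hΔ : Tendsto (fun N => δ N / Real.sqrt N) atTop (nhds 0) := hΔ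
  replace hΛ : Tendsto (fun N => Λ N / Real.sqrt N) atTop (nhds 0) := hΛ
  let u : ℕ → ℝ := fun N => (r ^ 3 * (N : ℝ) * sin θ ^ 2 / (N * d)) *
    (N * d / r + cos θ * lg N + (cos (2 * θ) / sin θ) * Ξ N)
  let v : ℕ → ℝ := fun N => N - u N / r ^ 2
  let p : ℕ → ℝ := fun N => (r ^ 2 * (N : ℝ) * sin θ / (N * d)) * (δ N / r + cos θ * Λ N)
  let q : ℕ → ℝ := fun N => (r * (N : ℝ) / (N * d)) * Λ N - (cos θ / (r * sin θ)) * p N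
  let e : ℕ → ℝ := fun N => (r ^ 2 * (N : ℝ) * sin θ / (N * d)) *
    ((1 / 2) * lg N + (cos θ / sin θ) * Ξ N) - (cos θ / (r * sin θ)) * u N
  have hform (N : ℕ) : ulaCRBr d r θ ρ L f_c Δf M N =
      (N * M * ((M : ℝ) * f_c ^ 2 + (M : ℝ) * ((M : ℝ) ^ 2 - 1) * Δf ^ 2 / 12) * u N +
        ((M : ℝ) * ((M : ℝ) * f_c ^ 2 + (M : ℝ) * ((M : ℝ) ^ 2 - 1) * Δf ^ 2 / 12) -
          2 * ((M : ℝ) * f_c) ^ 2) * p N ^ 2) /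
      (4 * ρ * L * ((M : ℝ) * f_c ^ 2 + (M : ℝ) * ((M : ℝ) ^ 2 - 1) * Δf ^ 2 / 12) *
        (N * M * ((M : ℝ) * f_c ^ 2 + (M : ℝ) * ((M : ℝ) ^ 2 - 1) * Δf ^ 2 / 12) *
          (u N * v N - e N ^ 2) +
        ((M : ℝ) * ((M : ℝ) * f_c ^ 2 + (M : ℝ) * ((M : ℝ) ^ 2 - 1) * Δf ^ 2 / 12) -
          2 * ((M : ℝ) * f_c) ^ 2) * (u N * q N ^ 2 + v N * p N ^ 2 - 2 * e N * p N * q N))) :=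
    rfl
  let a : ℕ → ℝ := fun N => r ^ 3 * sin θ ^ 2 / d * (cos θ * lg N + cos (2 * θ) / sin θ * Ξ N)
  let b : ℕ → ℝ := fun N => r ^ 2 * sin θ / d * (1 / 2 * lg N + cos θ / sin θ * Ξ N)
  have ha := ((hlg.const_mul (cos θ)).add (hΞ.const_mul (cos (2 * θ) / sin θ))).const_mul
    (r ^ 3 * sin θ ^ 2 / d)
  have hb := ((hlg.const_mul (1 / 2)).add (hΞ.const_mul (cos θ / sin θ))).const_mul
    (r ^ 2 * sin θ / d)
  replace ha : Tendsto a atTop _ := ha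
  replace hb : Tendsto b atTop _ := hb
  have hua : ∀ N : ℕ, (0 : ℝ) < N → u N = r ^ 2 * sin θ ^ 2 * N + a N := by
    intro N hN
    simp only [u, a]
    field_simp
    ring
  have heb : ∀ N : ℕ, (0 : ℝ) < N → e N = b N - cos θ / (r * sin θ) * u N := by
    intro N hN
    simp only [e, b]
    field_simp
  have hu : Tendsto (fun N => u N / N) atTop (nhds (r ^ 2 * sin θ ^ 2)) := by
    have h := (ha.mul hinv).const_add (r ^ 2 * sin θ ^ 2)
    rw [mul_zero, add_zero] at h
    refine h.congr' ?_
    filter_upwards [hn0] with N hN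
    rw [hua N hN]
    field_simp
  have hv : Tendsto (fun N => v N / N) atTop (nhds (1 - r ^ 2 * sin θ ^ 2 / r ^ 2)) := by
    refine ((hu.div_const (r ^ 2)).const_sub 1).congr' ?_
    filter_upwards [hn0] with N hN
    simp only [v]
    field_simp
  have he : Tendsto (fun N => e N / N) atTop
      (nhds (0 - cos θ / (r * sin θ) * (r ^ 2 * sin θ ^ 2))) := by
    have h := (hb.mul hinv).sub (hu.const_mul (cos θ / (r * sin θ)))
    rw [mul_zero] at h
    refine h.congr' ?_
    filter_upwards [hn0] with N hN
    rw [heb N hN]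
    field_simp
  have hp : Tendsto (fun N => p N / Real.sqrt N) atTop (nhds 0) := by
    have h := ((hΔ.div_const r).add (hΛ.const_mul (cos θ))).const_mul (r ^ 2 * sin θ / d)
    rw [zero_div, mul_zero, add_zero, mul_zero] at h
    refine h.congr' ?_
    filter_upwards [hn0] with N hN
    have := (Real.sqrt_pos.mpr hN).ne'
    simp only [p]
    field_simp
  have hq : Tendsto (fun N => q N / Real.sqrt N) atTop (nhds 0) := by
    have h := (hΛ.const_mul (r / d)).sub (hp.const_mul (cos θ / (r * sin θ)))
    rw [mul_zero, mul_zero, sub_zero] at h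
    refine h.congr' ?_
    filter_upwards [hn0] with N hN
    have := (Real.sqrt_pos.mpr hN).ne'
    simp only [q]
    field_simp
  have hφ : Tendsto (fun N => (u N * v N - e N ^ 2) / N) atTop
      (nhds (r ^ 3 * sin θ * π / d)) := by
    have h := (hu.mul ((hb.const_mul (2 * cos θ / (r * sin θ))).sub
      (ha.div_const (r ^ 2 * sin θ ^ 2)))).sub ((hb.pow 2).mul hinv)
    have hlim : r ^ 2 * sin θ ^ 2 * (2 * cos θ / (r * sin θ) *
        (r ^ 2 * sin θ / d * (1 / 2 * 0 + cos θ / sin θ * π)) -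
        r ^ 3 * sin θ ^ 2 / d * (cos θ * 0 + cos (2 * θ) / sin θ * π) / (r ^ 2 * sin θ ^ 2)) -
        (r ^ 2 * sin θ / d * (1 / 2 * 0 + cos θ / sin θ * π)) ^ 2 * 0 =
        r ^ 3 * sin θ * π / d := by
      rw [cos_two_mul]
      field_simp
      ring
    rw [hlim] at h
    refine h.congr' ?_
    filter_upwards [hn0] with N hN
    have hsc : cos θ ^ 2 = 1 - sin θ ^ 2 := cos_sq' θ
    simp only [v]
    rw [heb N hN]
    have haN : a N = u N - r ^ 2 * sin θ ^ 2 * N := by rw [hua N hN]; ring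
    rw [haN]
    field_simp
    ring_nf
    rw [hsc]
    ring
  have hM₂' : (0 : ℝ) < (M : ℝ) * f_c ^ 2 + (M : ℝ) * ((M : ℝ) ^ 2 - 1) * Δf ^ 2 / 12 := by
    have : (M : ℝ) * f_c ^ 2 + (M : ℝ) * ((M : ℝ) ^ 2 - 1) * Δf ^ 2 / 12 =
      M * (12 * f_c ^ 2 + ((M : ℝ) ^ 2 - 1) * Δf ^ 2) / 12 := by ring
    rw [this]
    positivity
  have h := tendsto_crb_quotient_s17 (M : ℝ)
    ((M : ℝ) * f_c ^ 2 + (M : ℝ) * ((M : ℝ) ^ 2 - 1) * Δf ^ 2 / 12)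
    ((M : ℝ) * ((M : ℝ) * f_c ^ 2 + (M : ℝ) * ((M : ℝ) ^ 2 - 1) * Δf ^ 2 / 12) -
      2 * ((M : ℝ) * f_c) ^ 2)
    (4 * ρ * L * ((M : ℝ) * f_c ^ 2 + (M : ℝ) * ((M : ℝ) ^ 2 - 1) * Δf ^ 2 / 12))
    hn hu hv he hp hq hφ (by positivity)
  simp only [hform]
  convert h using 2
  rw [show 12 * f_c ^ 2 + ((M : ℝ) * Δf) ^ 2 - Δf ^ 2 =
    12 * ((M : ℝ) * f_c ^ 2 + (M : ℝ) * ((M : ℝ) ^ 2 - 1) * Δf ^ 2 / 12) / M by field_simp; ring]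
  set m := (M : ℝ) * f_c ^ 2 + (M : ℝ) * ((M : ℝ) ^ 2 - 1) * Δf ^ 2 / 12
  field_simp
  ring
end

section
/- Fix positive integers N, M and positive reals ρ, L, f_c, Δf, R, r with R < r, and suppose N·M·M₂·u_r + U·c_r² ≠ 0, where the intermediates are the uniform-circular-array values u_θ = N R²/2, u_r = N(1 − R²/(2r²)), c_θ = 0, c_r = N·Υ(r/R), ε = 0. Then CRB_r = 3 / ( ρ L N M · [ 12 f_c² (1 − R²/(2r²) − Υ²(r/R)) + (B² − Δf²)(1 − R²/(2r²) + Υ²(r/R)) ] ). -/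
open Real

/-- Theorem 2's closed-form distance CRB for a uniform circular
array of radius `R` with an outside target at distance `r > R`. -/
theorem uca_crb_r_outside (N M : ℕ) (hN : 0 < N) (hM : 0 < M)
    (ρ L f_c Δf R r : ℝ)
    (hρ : 0 < ρ) (hL : 0 < L) (hfc : 0 < f_c) (hΔf : 0 < Δf) (hR : 0 < R) (hr : 0 < r)
    (hRr : R < r)
    (B M₁ M₂ U uθ ur cθ cr ε φ ψ CRBr : ℝ)
    (hB : B = M * Δf) (hM₁ : M₁ = M * f_c)
    (hM₂ : M₂ = M * f_c ^ 2 + M * ((M : ℝ) ^ 2 - 1) * Δf ^ 2 / 12)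
    (hU : U = M * M₂ - 2 * M₁ ^ 2)
    (huθ : uθ = N * R ^ 2 / 2)
    (hur : ur = N * (1 - R ^ 2 / (2 * r ^ 2)))
    (hcθ : cθ = 0)
    (hcr : cr = N * Upsilon (r / R))
    (hε : ε = 0)
    (hφ : φ = uθ * ur - ε ^ 2)
    (hψ : ψ = uθ * cr ^ 2 + ur * cθ ^ 2 - 2 * ε * cθ * cr)
    (hden : (N : ℝ) * M * M₂ * ur + U * cr ^ 2 ≠ 0)
    (hCRB : CRBr = ((N : ℝ) * M * M₂ * uθ + U * cθ ^ 2) /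
      (4 * ρ * L * M₂ * ((N : ℝ) * M * M₂ * φ + U * ψ))) :
    CRBr = 3 / (ρ * L * N * M *
      (12 * f_c ^ 2 * (1 - R ^ 2 / (2 * r ^ 2) - Upsilon (r / R) ^ 2) +
        (B ^ 2 - Δf ^ 2) * (1 - R ^ 2 / (2 * r ^ 2) + Upsilon (r / R) ^ 2))) := by
  have hN' : (N : ℝ) ≠ 0 := by positivity
  have hM' : (M : ℝ) ≠ 0 := by positivity
  have hM1 : (1 : ℝ) ≤ M := by exact_mod_cast hM
  have hM₂0 : M₂ ≠ 0 := by
    have hsq : (0 : ℝ) ≤ (M : ℝ) ^ 2 - 1 := by nlinarith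
    rw [hM₂]
    positivity
  have huθ0 : uθ ≠ 0 := by
    rw [huθ]
    positivity
  set D := (N : ℝ) * M * M₂ * ur + U * cr ^ 2 with hD
  have hfactor : (N : ℝ) * M * M₂ * φ + U * ψ = uθ * D := by
    rw [hφ, hψ, hcθ, hε, hD]
    ring
  have hbracket : 12 * f_c ^ 2 * (1 - R ^ 2 / (2 * r ^ 2) - Upsilon (r / R) ^ 2) +
      (B ^ 2 - Δf ^ 2) * (1 - R ^ 2 / (2 * r ^ 2) + Upsilon (r / R) ^ 2) =
      12 * D / ((N : ℝ) ^ 2 * M ^ 2) := by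
    rw [eq_div_iff (by positivity), hD, hU, hM₁, hM₂, hur, hcr, hB]
    ring
  rw [hCRB, hfactor, hbracket, hcθ]
  field_simp
  ring
end
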